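/- arXiv:0710.0027 — 3 statements merged into one kernel-verified Lean document; each statement's English description precedes it below -/
import Mathlib

section
/- For all positive integers Δ and k there exists a constant c(Δ,k) such that every k-uniform hypergraph H with n vertices and maximum degree at most Δ has Ramsey number r(H) ≤ c(Δ,k)·n. -/
open Finset

/-- Off-diagonal finite Ramsey theorem for two-colourings of the `k`-subsets of a finite set. -/
theorem exists_ramsey (k : ℕ) : ∀ p q : ℕ, ∃ m : ℕ, ∀ (α : Type) [DecidableEq α]
    (S : Finset α), m ≤ #S → ∀ χ : Finset α → Bool,
      (∃ A ⊆ S, #A = p ∧ ∀ I ⊆ A, #I = k → χ I = true) ∨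
      (∃ A ⊆ S, #A = q ∧ ∀ I ⊆ A, #I = k → χ I = false) := by
  induction k with
  | zero =>
    intro p q
    refine ⟨max p q, fun α _ S hS χ => ?_⟩
    obtain ⟨A, hA, hAp⟩ := exists_subset_card_eq ((le_max_left p q).trans hS)
    obtain ⟨B, hB, hBq⟩ := exists_subset_card_eq ((le_max_right p q).trans hS)
    cases h : χ ∅ with
    | true => exact .inl ⟨A, hA, hAp, fun I _ hI => by rw [card_eq_zero.1 hI, h]⟩
    | false => exact .inr ⟨B, hB, hBq, fun I _ hI => by rw [card_eq_zero.1 hI, h]⟩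
  | succ k ih =>
    intro p
    induction p with
    | zero =>
      intro q
      refine ⟨0, fun α _ S _ χ => .inl ⟨∅, empty_subset _, rfl, fun I hI hk => ?_⟩⟩
      simp [subset_empty.1 hI] at hk
    | succ p ihp =>
      intro q
      induction q with
      | zero =>
        refine ⟨0, fun α _ S _ χ => .inr ⟨∅, empty_subset _, rfl, fun I hI hk => ?_⟩⟩
        simp [subset_empty.1 hI] at hk
      | succ q ihq =>
        obtain ⟨m₁, h₁⟩ := ihp (q + 1)
        obtain ⟨m₂, h₂⟩ := ihq
        obtain ⟨m, hm⟩ := ih m₁ m₂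
        refine ⟨m + 1, fun α _ S hS χ => ?_⟩
        obtain ⟨a, ha⟩ : S.Nonempty := card_pos.1 (by omega)
        have key : ∀ (b : Bool) (A B : Finset α) (t : ℕ), A ⊆ S.erase a →
            (∀ I ⊆ A, #I = k → χ (insert a I) = b) → B ⊆ A → #B = t →
            (∀ I ⊆ B, #I = k + 1 → χ I = b) →
            ∃ C ⊆ S, #C = t + 1 ∧ ∀ I ⊆ C, #I = k + 1 → χ I = b := by
          intro b A B t hA hAb hBA hBt hB
          have haB : a ∉ B := fun h => by simpa using hA (hBA h)
          refine ⟨insert a B, ?_, by rw [card_insert_of_notMem haB, hBt], fun I hI hk => ?_⟩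
          · exact insert_subset ha ((hBA.trans hA).trans (erase_subset _ _))
          · by_cases haI : a ∈ I
            · rw [← insert_erase haI]
              refine hAb _ (Subset.trans ?_ hBA) (by rw [card_erase_of_mem haI, hk]; rfl)
              rw [← erase_insert haB]
              exact erase_subset_erase _ hI
            · exact hB I (by rwa [subset_insert_iff_of_notMem haI] at hI) hk
        have hcard : m ≤ #(S.erase a) := by rw [card_erase_of_mem ha]; omega
        rcases hm α (S.erase a) hcard (fun I => χ (insert a I)) with
          ⟨A, hA, hAm, hAb⟩ | ⟨A, hA, hAm, hAb⟩
        · rcases h₁ α A hAm.ge χ with ⟨B, hB, hBt, hBb⟩ | ⟨B, hB, hBt, hBb⟩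
          · exact .inl (key true A B p hA hAb hB hBt hBb)
          · exact .inr ⟨B, (hB.trans hA).trans (erase_subset _ _), hBt, hBb⟩
        · rcases h₂ α A hAm.ge χ with ⟨B, hB, hBt, hBb⟩ | ⟨B, hB, hBt, hBb⟩
          · exact .inl ⟨B, (hB.trans hA).trans (erase_subset _ _), hBt, hBb⟩
          · exact .inr (key false A B q hA hAb hB hBt hBb)

/-- Swapping the values of `u` along an injection `g` with an independent tuple `v` is a
bijection. -/
theorem sum_sum_extend {ι κ V M : Type*} [Fintype ι] [Fintype κ] [Fintype V] [DecidableEq ι]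
    [DecidableEq κ] [AddCommMonoid M] {g : ι → κ} (hg : g.Injective) (F : (κ → V) → M) :
    ∑ u : κ → V, ∑ v : ι → V, F (Function.extend g v u) = ∑ u : κ → V, ∑ _v : ι → V, F u := by
  rw [← Fintype.sum_prod_type', ← Fintype.sum_prod_type']
  let φ : (κ → V) × (ι → V) → (κ → V) × (ι → V) := fun a => (Function.extend g a.2 a.1, a.1 ∘ g)
  have hφ : Function.Involutive φ := by
    rintro ⟨u, v⟩
    refine Prod.ext (funext fun j => ?_) (funext fun i => ?_)
    · by_cases hj : ∃ i, g i = j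
      · obtain ⟨i, rfl⟩ := hj
        simp [φ, hg.extend_apply]
      · simp [φ, Function.extend_apply' _ _ _ hj]
    · simp [φ, hg.extend_apply]
  exact Equiv.sum_comp hφ.toPerm (fun a => F a.1)

/-- Resampling one coordinate preserves uniform averages. -/
theorem sum_sum_update {κ V M : Type*} [Fintype κ] [Fintype V] [DecidableEq κ] [AddCommMonoid M]
    (i : κ) (F : (κ → V) → M) :
    ∑ v : κ → V, ∑ u : V, F (Function.update v i u) = Fintype.card V • ∑ v : κ → V, F v := by
  rw [← Fintype.sum_prod_type']
  let φ : (κ → V) × V → (κ → V) × V := fun a => (Function.update a.1 i a.2, a.1 i)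
  have hφ : Function.Involutive φ := by
    rintro ⟨v, u⟩
    simp [φ]
  refine (Equiv.sum_comp hφ.toPerm (fun a => F a.1)).trans ?_
  rw [Fintype.sum_prod_type]
  simp [Finset.smul_sum]

/-- Every two-colouring has a positive proportion of homogeneous `r`-tuples in one colour. -/
theorem exists_dense_homogeneous (k r : ℕ) : ∃ ε : ℝ, 0 < ε ∧ ∀ N : ℕ, 0 < N →
    ∀ χ : Finset (Fin N) → Bool, ∃ b : Bool,
      ε * (N : ℝ) ^ r ≤ #{v : Fin r → Fin N | ∀ I : Finset (Fin r), #I = k → χ (I.image v) = b} := by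
  obtain ⟨m, hm⟩ := exists_ramsey k r r
  have hm' : ∀ (N : ℕ) (χ : Finset (Fin N) → Bool) (u : Fin m → Fin N),
      ∃ a : (Fin r ↪ Fin m) × Bool, ∀ I : Finset (Fin r), #I = k →
        χ (I.image (u ∘ a.1)) = a.2 := by
    intro N χ u
    have key : ∀ b : Bool, (∃ A ⊆ (univ : Finset (Fin m)), #A = r ∧
        ∀ I ⊆ A, #I = k → χ (I.image u) = b) → ∃ a : (Fin r ↪ Fin m) × Bool,
        ∀ I : Finset (Fin r), #I = k → χ (I.image (u ∘ a.1)) = a.2 := by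
      rintro b ⟨A, -, hA, hb⟩
      refine ⟨((A.orderEmbOfFin hA).toEmbedding, b), fun I hI => ?_⟩
      rw [← image_image]
      refine hb _ (fun j hj => ?_) ?_
      · obtain ⟨i, -, rfl⟩ := mem_image.1 hj
        exact A.orderEmbOfFin_mem hA i
      · exact (card_image_of_injective _ (A.orderEmbOfFin hA).injective).trans hI
    rcases hm (Fin m) univ (by simp) (fun I => χ (I.image u)) with h | h
    · exact key true h
    · exact key false h
  refine ⟨1 / (Fintype.card ((Fin r ↪ Fin m) × Bool) + 1), by positivity, fun N hN χ => ?_⟩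
  by_contra! hlt
  set T : ℝ := (Fintype.card ((Fin r ↪ Fin m) × Bool) : ℝ) with hT
  have hT0 : 0 ≤ T := Nat.cast_nonneg _
  have hNr : (0 : ℝ) < N := Nat.cast_pos.2 hN
  let G : Bool → (Fin r → Fin N) → Prop := fun b v =>
    ∀ I : Finset (Fin r), #I = k → χ (I.image v) = b
  have hcount : ∀ a : (Fin r ↪ Fin m) × Bool,
      (#{u : Fin m → Fin N | G a.2 (u ∘ a.1)} : ℝ) ≤ 1 / (T + 1) * (N : ℝ) ^ m := by
    rintro ⟨g, b⟩
    have h := sum_sum_extend (V := Fin N) g.injective (fun u => if G b (u ∘ g) then (1 : ℝ) else 0)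
    simp only [Function.extend_comp g.injective, sum_const, card_univ, Fintype.card_pi_const,
      Fintype.card_fin, nsmul_eq_mul, ← mul_sum, sum_boole, Nat.cast_pow] at h
    have hb : (#{v : Fin r → Fin N | G b v} : ℝ) < 1 / (T + 1) * (N : ℝ) ^ r := hlt b
    refine le_of_mul_le_mul_left ?_ (pow_pos hNr r)
    rw [← h]
    calc (N : ℝ) ^ m * _ ≤ (N : ℝ) ^ m * (1 / (T + 1) * (N : ℝ) ^ r) := by gcongr
      _ = _ := by ring
  have htot : (N : ℝ) ^ m ≤ ∑ a : (Fin r ↪ Fin m) × Bool,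
      (#{u : Fin m → Fin N | G a.2 (u ∘ a.1)} : ℝ) := by
    have : (univ : Finset (Fin m → Fin N)) ⊆
        univ.biUnion fun a : (Fin r ↪ Fin m) × Bool =>
          {u : Fin m → Fin N | G a.2 (u ∘ a.1)} := by
      intro u _
      obtain ⟨a, ha⟩ := hm' N χ u
      exact mem_biUnion.2 ⟨a, mem_univ _, by simpa using ha⟩
    have h := (card_le_card this).trans card_biUnion_le
    rw [card_univ, Fintype.card_pi_const, Fintype.card_fin] at h
    exact_mod_cast h
  have hsum := htot.trans (sum_le_sum fun a _ => hcount a)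
  rw [sum_const, card_univ, nsmul_eq_mul, ← hT] at hsum
  have hpos := pow_pos hNr m
  have : T * (1 / (T + 1) * (N : ℝ) ^ m) = (N : ℝ) ^ m - (N : ℝ) ^ m / (T + 1) := by
    field_simp
    ring
  have h3 : 0 < (N : ℝ) ^ m / (T + 1) := by positivity
  linarith

/-- Greedy colouring: a symmetric relation with at most `d` neighbours of every vertex has a
proper colouring with `d + 1` colours. -/
theorem exists_greedy_coloring {V : Type*} [Fintype V] [DecidableEq V] (d : ℕ)
    (adj : V → V → Prop) [DecidableRel adj] (hsymm : ∀ v w, adj v w → adj w v)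
    (hd : ∀ v, #{w | adj v w} ≤ d) :
    ∃ c : V → Fin (d + 1), ∀ v w, v ≠ w → adj v w → c v ≠ c w := by
  suffices h : ∀ P : Finset V, ∃ c : V → Fin (d + 1),
      ∀ v ∈ P, ∀ w ∈ P, v ≠ w → adj v w → c v ≠ c w by
    obtain ⟨c, hc⟩ := h univ
    exact ⟨c, fun v w => hc v (mem_univ _) w (mem_univ _)⟩
  intro P
  induction P using Finset.induction_on with
  | empty => exact ⟨fun _ => 0, by simp⟩
  | insert a P ha ih =>
    obtain ⟨c, hc⟩ := ih
    obtain ⟨i, -, hi⟩ : ∃ i ∈ (univ : Finset (Fin (d + 1))),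
        i ∉ ({w | adj a w} : Finset V).image c :=
      exists_mem_notMem_of_card_lt_card
        (card_image_le.trans_lt (by simpa using Nat.lt_succ_of_le (hd a)))
    have hi' : ∀ w, adj a w → c w ≠ i := fun w hw h =>
      hi (mem_image.2 ⟨w, by simpa using hw, h⟩)
    refine ⟨Function.update c a i, fun v hv w hw hvw hadj => ?_⟩
    rcases mem_insert.1 hv with rfl | hv
    · rw [Function.update_self, Function.update_of_ne hvw.symm]
      exact (hi' w hadj).symm
    · rcases mem_insert.1 hw with rfl | hw
      · rw [Function.update_self, Function.update_of_ne hvw]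
        exact hi' v (hsymm _ _ hadj)
      · rw [Function.update_of_ne (ne_of_mem_of_not_mem hv ha),
          Function.update_of_ne (ne_of_mem_of_not_mem hw ha)]
        exact hc v hv w hw hvw hadj

/-- A bounded degree uniform hypergraph has a colouring, with boundedly many colours, in which any
two vertices lying in intersecting edges have distinct colours. -/
theorem exists_strong_coloring {n Δ k : ℕ} {H : Finset (Finset (Fin n))}
    (hk : ∀ e ∈ H, #e = k) (hΔ : ∀ v, #{e ∈ H | v ∈ e} ≤ Δ) :
    ∃ c : Fin n → Fin ((Δ * k) * (Δ * k) + 1), ∀ e ∈ H, ∀ e' ∈ H, (e ∩ e').Nonempty →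
      ∀ s ∈ e, ∀ t ∈ e', c s = c t → s = t := by
  let nb : Fin n → Finset (Fin n) := fun v => {e ∈ H | v ∈ e}.biUnion id
  have hnb : ∀ v, #(nb v) ≤ Δ * k := fun v =>
    (card_biUnion_le_card_mul _ _ k fun e he => (hk e (mem_filter.1 he).1).le).trans
      (Nat.mul_le_mul_right _ (hΔ v))
  have mem_nb : ∀ {v w e}, e ∈ H → v ∈ e → w ∈ e → w ∈ nb v := fun he hv hw =>
    mem_biUnion.2 ⟨_, mem_filter.2 ⟨he, hv⟩, hw⟩
  have nb_symm : ∀ v w, w ∈ nb v → v ∈ nb w := by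
    intro v w h
    obtain ⟨e, he, hw⟩ := mem_biUnion.1 h
    exact mem_nb (mem_filter.1 he).1 hw (mem_filter.1 he).2
  obtain ⟨c, hc⟩ := exists_greedy_coloring ((Δ * k) * (Δ * k))
    (fun v w => w ∈ (nb v).biUnion nb)
    (by
      intro v w h
      obtain ⟨x, hx, hw⟩ := mem_biUnion.1 h
      exact mem_biUnion.2 ⟨x, nb_symm _ _ hw, nb_symm _ _ hx⟩)
    (by
      intro v
      rw [filter_mem_eq_inter, univ_inter]
      exact (card_biUnion_le_card_mul _ _ _ fun x _ => hnb x).trans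
        (Nat.mul_le_mul_right _ (hnb v)))
  refine ⟨c, fun e he e' he' ⟨x, hx⟩ s hs t ht hst => by_contra fun hne => hc s t hne ?_ hst⟩
  rw [mem_inter] at hx
  exact mem_biUnion.2 ⟨x, mem_nb he hs hx.1, mem_nb he' hx.2 ht⟩

section Backup

variable {ι V : Type*} [Fintype ι] [Fintype V] [DecidableEq ι] [DecidableEq V]

/-- The values `u` for coordinate `i` such that, for every `J ∈ A`, the tuple with value `u` at
`i`, given by `x` on `J` and by `v` elsewhere, lies in `G`. -/
def candidates (G : Finset (ι → V)) (A : Finset (Finset ι)) (i : ι) (v x : ι → V) : Finset V :=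
  {u | ∀ J ∈ A, Function.update (J.piecewise x v) i u ∈ G}

/-- `x` is deficient with respect to `v` if `v i` is a candidate for coordinate `i`, but there are
few candidates. -/
def IsDeficient (G : Finset (ι → V)) (β : ℝ) (A : Finset (Finset ι)) (i : ι) (v x : ι → V) : Prop :=
  v i ∈ candidates G A i v x ∧ (#(candidates G A i v x) : ℝ) < β * Fintype.card V

theorem candidates_update (G : Finset (ι → V)) (A : Finset (Finset ι)) (i : ι) (v x : ι → V)
    (u : V) : candidates G A i (Function.update v i u) x = candidates G A i v x := by
  have : ∀ (J : Finset ι) (u' : V), Function.update (J.piecewise x (Function.update v i u)) i u' =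
      Function.update (J.piecewise x v) i u' := by
    intro J u'
    ext j
    by_cases hj : j = i
    · simp [hj]
    · simp [hj, Finset.piecewise]
  simp [candidates, this]

open Classical in
theorem sum_card_isDeficient_le (G : Finset (ι → V)) {β : ℝ} (hβ : 0 ≤ β) (A : Finset (Finset ι))
    (i : ι) : ∑ v : ι → V, (#{x | IsDeficient G β A i v x} : ℝ) ≤
      Fintype.card (ι → V) * (β * Fintype.card (ι → V)) := by
  have hx : ∀ x : ι → V, ∑ v : ι → V, (if IsDeficient G β A i v x then (1 : ℝ) else 0) ≤
      β * Fintype.card (ι → V) := by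
    intro x
    rcases isEmpty_or_nonempty V with hV | hV
    · have : IsEmpty (ι → V) := ⟨fun x => hV.elim (x i)⟩
      simp
    have hN : (0 : ℝ) < Fintype.card V := Nat.cast_pos.2 Fintype.card_pos
    have h := sum_sum_update (V := V) i
      (fun v => if IsDeficient G β A i v x then (1 : ℝ) else 0)
    refine le_of_mul_le_mul_left ?_ hN
    rw [← nsmul_eq_mul, ← h]
    have hv : ∀ v : ι → V, ∑ u : V,
        (if IsDeficient G β A i (Function.update v i u) x then (1 : ℝ) else 0) ≤
          β * Fintype.card V := by
      intro v
      simp only [IsDeficient, candidates_update, Function.update_self]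
      by_cases hlt : (#(candidates G A i v x) : ℝ) < β * Fintype.card V
      · simpa [hlt] using hlt.le
      · simp only [hlt, and_false, if_false, sum_const_zero]
        positivity
    refine (sum_le_sum fun v _ => hv v).trans_eq ?_
    rw [sum_const, card_univ, nsmul_eq_mul]
    ring
  calc ∑ v : ι → V, (#{x | IsDeficient G β A i v x} : ℝ)
      = ∑ x : ι → V, ∑ v : ι → V, (if IsDeficient G β A i v x then (1 : ℝ) else 0) := by
        rw [sum_comm]
        exact sum_congr rfl fun v _ => by rw [sum_boole]
    _ ≤ ∑ _x : ι → V, β * Fintype.card (ι → V) := sum_le_sum fun x _ => hx x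
    _ = _ := by rw [sum_const, card_univ, nsmul_eq_mul]

open Classical in
/-- A dense set `G` of tuples contains a tuple with respect to which, for every type `(i, A)`,
few tuples are deficient. -/
theorem exists_backup [Nonempty V] {G : Finset (ι → V)} {ε : ℝ} (hε : 0 < ε)
    (hG : ε * Fintype.card (ι → V) ≤ #G) {β : ι → ℝ} (hβ : ∀ i, 0 < β i) :
    ∃ v ∈ G, ∀ (i : ι) (A : Finset (Finset ι)), (#{x | IsDeficient G (β i) A i v x} : ℝ) ≤
      (Fintype.card (ι × Finset (Finset ι)) + 1) / ε * β i * Fintype.card (ι → V) := by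
  set T : ℝ := (Fintype.card (ι × Finset (Finset ι)) : ℝ) with hT
  set M : ℝ := (Fintype.card (ι → V) : ℝ) with hM
  have hT0 : 0 ≤ T := Nat.cast_nonneg _
  have hM0 : 0 < M := Nat.cast_pos.2 Fintype.card_pos
  by_contra! hcon
  have h1 : ∀ v ∈ G, (T + 1) / ε * M ≤ ∑ a : ι × Finset (Finset ι),
      (#{x | IsDeficient G (β a.1) a.2 a.1 v x} : ℝ) / β a.1 := by
    intro v hv
    obtain ⟨i, A, hiA⟩ := hcon v hv
    refine le_trans ?_ (single_le_sum (f := fun a : ι × Finset (Finset ι) =>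
      (#{x | IsDeficient G (β a.1) a.2 a.1 v x} : ℝ) / β a.1)
      (fun a _ => div_nonneg (Nat.cast_nonneg _) (hβ _).le) (mem_univ (i, A)))
    rw [le_div_iff₀ (hβ i)]
    linarith
  have h2 : ∑ v : ι → V, ∑ a : ι × Finset (Finset ι),
      (#{x | IsDeficient G (β a.1) a.2 a.1 v x} : ℝ) / β a.1 ≤ T * (M * M) := by
    rw [sum_comm]
    calc _ ≤ ∑ _a : ι × Finset (Finset ι), M * M := by
          refine sum_le_sum fun a _ => ?_
          rw [← sum_div, div_le_iff₀ (hβ _)]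
          exact (sum_card_isDeficient_le G (hβ _).le a.2 a.1).trans_eq (by ring)
      _ = _ := by rw [sum_const, card_univ, nsmul_eq_mul]
  have h3 : (#G : ℝ) * ((T + 1) / ε * M) ≤ T * (M * M) := by
    refine le_trans ?_ h2
    rw [← nsmul_eq_mul, ← sum_const]
    refine (sum_le_sum h1).trans (sum_le_sum_of_subset_of_nonneg (subset_univ _) fun v _ _ => ?_)
    exact sum_nonneg fun a _ => div_nonneg (Nat.cast_nonneg _) (hβ _).le
  have h4 : ε * M * ((T + 1) / ε * M) ≤ #G * ((T + 1) / ε * M) := by gcongr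
  have h5 : ε * M * ((T + 1) / ε * M) = T * (M * M) + M * M := by
    field_simp
  nlinarith [mul_pos hM0 hM0]

end Backup

section Overwrite

variable {W ι V : Type*}

open Classical in
/-- The tuple `x` with its `c s`-coordinate replaced by `f s` for all `s ∈ Q`. -/
noncomputable def overwrite (c : W → ι) (Q : Finset W) (f : W → V) (x : ι → V) : ι → V := fun j =>
  if h : ∃ s ∈ Q, c s = j then f h.choose else x j

variable {c : W → ι} {Q : Finset W} {f g : W → V} {x : ι → V}

theorem overwrite_apply (hc : Set.InjOn c Q) {s : W} (hs : s ∈ Q) :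
    overwrite c Q f x (c s) = f s := by
  have h : ∃ t ∈ Q, c t = c s := ⟨s, hs, rfl⟩
  rw [overwrite, dif_pos h, hc h.choose_spec.1 hs h.choose_spec.2]

theorem overwrite_of_forall_ne {j : ι} (hj : ∀ s ∈ Q, c s ≠ j) : overwrite c Q f x j = x j := by
  rw [overwrite, dif_neg]
  rintro ⟨s, hs, h⟩
  exact hj s hs h

theorem overwrite_congr (h : ∀ s ∈ Q, f s = g s) : overwrite c Q f x = overwrite c Q g x := by
  funext j
  unfold overwrite
  split_ifs with hj
  · exact h _ hj.choose_spec.1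
  · rfl

@[simp] theorem overwrite_empty : overwrite c ∅ f x = x :=
  funext fun _ => overwrite_of_forall_ne (by simp)

theorem overwrite_insert [DecidableEq W] [DecidableEq ι] {w : W}
    (hc : Set.InjOn c (insert w Q : Finset W)) (hw : w ∉ Q) (u : V) :
    overwrite c (insert w Q) (Function.update f w u) x =
      Function.update (overwrite c Q f x) (c w) u := by
  funext j
  by_cases hj : ∃ s ∈ insert w Q, c s = j
  · obtain ⟨s, hs, rfl⟩ := hj
    rw [overwrite_apply hc hs]
    rcases mem_insert.1 hs with rfl | hsQ
    · simp
    · have hsw : s ≠ w := ne_of_mem_of_not_mem hsQ hw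
      rw [Function.update_of_ne hsw, Function.update_of_ne
        (fun h => hsw (hc hs (mem_insert_self w Q) h)),
        overwrite_apply (hc.mono (by simp)) hsQ]
  · push Not at hj
    rw [overwrite_of_forall_ne hj, Function.update_of_ne (hj w (mem_insert_self _ _)).symm,
      overwrite_of_forall_ne fun s hs => hj s (mem_insert_of_mem hs)]

theorem update_overwrite [DecidableEq ι] {w : W} (hc : ∀ s ∈ Q, c s ≠ c w) (u : V) :
    Function.update (overwrite c Q f x) (c w) u =
      overwrite c Q f (Function.update x (c w) u) := by
  funext j
  by_cases hj : j = c w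
  · subst hj
    rw [overwrite_of_forall_ne hc]
    simp
  · rw [Function.update_of_ne hj]
    unfold overwrite
    rw [Function.update_of_ne hj]

end Overwrite

theorem injOn_edge {W ι : Type*} [DecidableEq W] {H : Finset (Finset W)} {c : W → ι}
    (hc : ∀ e ∈ H, ∀ e' ∈ H, (e ∩ e').Nonempty → ∀ s ∈ e, ∀ t ∈ e', c s = c t → s = t)
    {e : Finset W} (he : e ∈ H) : Set.InjOn c e := fun s hs t ht hst =>
  hc e he e he ⟨s, mem_inter.2 ⟨hs, hs⟩⟩ s hs t ht hst

section Embedding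

variable {W V : Type*} [Fintype W] [DecidableEq W] [Fintype V] {r : ℕ}

/-- The vertices of smaller colour sharing an edge with `w`. -/
def earlier (H : Finset (Finset W)) (c : W → Fin r) (w : W) : Finset W :=
  {s | ∃ e ∈ H, w ∈ e ∧ s ∈ e ∧ c s < c w}

/-- The colour sets of the edges at `w`, truncated below the colour of `w`. -/
def truncations (H : Finset (Finset W)) (c : W → Fin r) (w : W) : Finset (Finset (Fin r)) :=
  {e ∈ H | w ∈ e}.image fun e => ({s ∈ e | c s < c w} : Finset W).image c

theorem mem_earlier {H : Finset (Finset W)} {c : W → Fin r} {w s : W} :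
    s ∈ earlier H c w ↔ ∃ e ∈ H, w ∈ e ∧ s ∈ e ∧ c s < c w := by
  simp [earlier]

open Classical in
/-- A map `f` embedding the vertices in `P`, such that filling up with the values of `v` gives
tuples in `G` and such that the proportion of deficient extensions is controlled at all vertices. -/
structure IsPartialEmbedding [DecidableEq V] (H : Finset (Finset W)) (c : W → Fin r)
    (G : Finset (Fin r → V)) (v : Fin r → V) (β η M : Fin r → ℝ) (P : Finset W) (f : W → V) : Prop where
  injOn : Set.InjOn f P
  overwrite_mem : ∀ e ∈ H, overwrite c (e ∩ P) f v ∈ G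
  card_deficient_le : ∀ w, (#{x | IsDeficient G (β (c w)) (truncations H c w) (c w) v
    (overwrite c (earlier H c w ∩ P) f x)} : ℝ) ≤
      η (c w) * Fintype.card (Fin r → V) * ∏ s ∈ earlier H c w ∩ P, M (c s)

/-- Markov's inequality for the uniform measure. -/
theorem card_filter_lt_mul_le {g : V → ℝ} (hg : ∀ u, 0 ≤ g u) {B M : ℝ} (hB : 0 < B)
    (hsum : ∑ u, g u ≤ Fintype.card V * B) :
    (#{u | B * M < g u} : ℝ) * M ≤ Fintype.card V := by
  refine le_of_mul_le_mul_right ?_ hB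
  calc (#{u | B * M < g u} : ℝ) * M * B = ∑ u with B * M < g u, B * M := by
        rw [sum_const, nsmul_eq_mul]; ring
    _ ≤ ∑ u with B * M < g u, g u := sum_le_sum fun u hu => (mem_filter.1 hu).2.le
    _ ≤ ∑ u, g u := sum_le_sum_of_subset_of_nonneg (filter_subset _ _) fun u _ _ => hg u
    _ ≤ _ := hsum

theorem injOn_earlier {H : Finset (Finset W)} {c : W → Fin r}
    (hc : ∀ e ∈ H, ∀ e' ∈ H, (e ∩ e').Nonempty → ∀ s ∈ e, ∀ t ∈ e', c s = c t → s = t) (w : W) :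
    Set.InjOn c (earlier H c w) := by
  intro s hs t ht hst
  obtain ⟨e, he, hwe, hse, -⟩ := mem_earlier.1 hs
  obtain ⟨e', he', hwe', hte', -⟩ := mem_earlier.1 ht
  exact hc e he e' he' ⟨w, mem_inter.2 ⟨hwe, hwe'⟩⟩ s hse t hte' hst

variable [DecidableEq V] {H : Finset (Finset W)} {c : W → Fin r} {G : Finset (Fin r → V)}
  {v : Fin r → V} {β η M : Fin r → ℝ} {P : Finset W} {f : W → V}

/-- If all vertices preceding `w` are embedded, there are many ways to embed `w`. -/
theorem IsPartialEmbedding.exists_candidates [Nonempty V]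
    (hf : IsPartialEmbedding H c G v β η M P f)
    (hc : ∀ e ∈ H, ∀ e' ∈ H, (e ∩ e').Nonempty → ∀ s ∈ e, ∀ t ∈ e', c s = c t → s = t)
    (hη0 : ∀ i, 0 ≤ η i) (hM : ∀ i, 1 ≤ M i) (hη : ∀ i, η i * ∏ j ∈ Iio i, M j < 1)
    {w : W} (hw : w ∉ P) (hPw : ∀ s, c s < c w → s ∈ P) (hwP : ∀ s ∈ P, c s ≤ c w) :
    ∃ C : Finset V, β (c w) * Fintype.card V ≤ #C ∧
      ∀ u ∈ C, ∀ e ∈ H, w ∈ e → Function.update (overwrite c (e ∩ P) f v) (c w) u ∈ G := by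
  classical
  have hsub : earlier H c w ∩ P = earlier H c w := inter_eq_left.2 fun s hs => by
    obtain ⟨e, -, -, -, h⟩ := mem_earlier.1 hs
    exact hPw s h
  obtain ⟨x, hx⟩ : ∃ x, ¬ IsDeficient G (β (c w)) (truncations H c w) (c w) v
      (overwrite c (earlier H c w) f x) := by
    by_contra! hall
    have h := hf.card_deficient_le w
    rw [hsub, filter_true_of_mem fun x _ => hall x, card_univ, ← prod_image (injOn_earlier hc w)]
      at h
    have h2 : ∏ i ∈ (earlier H c w).image c, M i ≤ ∏ j ∈ Iio (c w), M j := by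
      refine prod_le_prod_of_subset_of_one_le (fun i hi => ?_)
        (fun i _ => zero_le_one.trans (hM i)) (fun i _ _ => hM i)
      obtain ⟨s, hs, rfl⟩ := mem_image.1 hi
      obtain ⟨e, -, -, -, h⟩ := mem_earlier.1 hs
      exact mem_Iio.2 h
    have hpos : (0 : ℝ) < Fintype.card (Fin r → V) := Nat.cast_pos.2 Fintype.card_pos
    have h3 := mul_le_mul_of_nonneg_left h2 (hη0 (c w))
    nlinarith [hη (c w)]
  set y := overwrite c (earlier H c w) f x with hy
  have hpiece : ∀ e ∈ H, w ∈ e →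
      (({s ∈ e | c s < c w} : Finset W).image c).piecewise y v = overwrite c (e ∩ P) f v := by
    intro e he hwe
    funext j
    have hinj : Set.InjOn c (e ∩ P : Finset W) :=
      (injOn_edge hc he).mono (by simp)
    by_cases hj : j ∈ ({s ∈ e | c s < c w} : Finset W).image c
    · rw [piecewise_eq_of_mem _ _ _ hj]
      obtain ⟨s, hs, rfl⟩ := mem_image.1 hj
      obtain ⟨hse, hsw⟩ := mem_filter.1 hs
      rw [overwrite_apply hinj (mem_inter.2 ⟨hse, hPw s hsw⟩), hy,
        overwrite_apply (injOn_earlier hc w) (mem_earlier.2 ⟨e, he, hwe, hse, hsw⟩)]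
    · rw [piecewise_eq_of_notMem _ _ _ hj, overwrite_of_forall_ne]
      rintro s hs rfl
      obtain ⟨hse, hsP⟩ := mem_inter.1 hs
      refine hj (mem_image_of_mem c (mem_filter.2 ⟨hse, lt_of_le_of_ne (hwP s hsP) fun h => ?_⟩))
      exact hw (injOn_edge hc he hse hwe h ▸ hsP)
  have hcand : ∀ u, u ∈ candidates G (truncations H c w) (c w) v y ↔
      ∀ e ∈ H, w ∈ e → Function.update (overwrite c (e ∩ P) f v) (c w) u ∈ G := by
    intro u
    simp only [candidates, truncations, mem_filter, mem_univ, true_and, forall_mem_image, and_imp]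
    exact forall₃_congr fun e he hwe => by rw [hpiece e he hwe]
  refine ⟨candidates G (truncations H c w) (c w) v y, ?_, fun u hu => (hcand u).1 hu⟩
  refine not_lt.1 fun hlt => hx ⟨(hcand _).2 fun e he hwe => ?_, hlt⟩
  have hself : overwrite c (e ∩ P) f v (c w) = v (c w) := by
    refine overwrite_of_forall_ne fun s hs h => ?_
    obtain ⟨hse, hsP⟩ := mem_inter.1 hs
    exact hw (injOn_edge hc he hse hwe h ▸ hsP)
  rw [← hself, Function.update_eq_self]
  exact hf.overwrite_mem e he

theorem IsPartialEmbedding.exists_insert [Nonempty V]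
    (hf : IsPartialEmbedding H c G v β η M P f)
    (hc : ∀ e ∈ H, ∀ e' ∈ H, (e ∩ e').Nonempty → ∀ s ∈ e, ∀ t ∈ e', c s = c t → s = t)
    {D : ℝ} (hD : ∀ w, (#{w' | w ∈ earlier H c w'} : ℝ) ≤ D)
    (hM : ∀ i, 1 ≤ M i) (hβM : ∀ i, β i * M i = 2 * D)
    (hη0 : ∀ i, 0 < η i) (hη : ∀ i, η i * ∏ j ∈ Iio i, M j < 1)
    (hcard : ∀ i, 2 * (Fintype.card W : ℝ) < β i * Fintype.card V)
    {w : W} (hw : w ∉ P) (hPw : ∀ s, c s < c w → s ∈ P) (hwP : ∀ s ∈ P, c s ≤ c w) :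
    ∃ u, IsPartialEmbedding H c G v β η M (insert w P) (Function.update f w u) := by
  classical
  obtain ⟨C, hC, hCG⟩ := hf.exists_candidates hc (fun i => (hη0 i).le) hM hη hw hPw hwP
  let B : W → ℝ := fun w' =>
    η (c w') * Fintype.card (Fin r → V) * ∏ s ∈ earlier H c w' ∩ P, M (c s)
  have hB : ∀ w', 0 < B w' := fun w' =>
    mul_pos (mul_pos (hη0 _) (Nat.cast_pos.2 Fintype.card_pos))
      (prod_pos fun s _ => zero_lt_one.trans_le (hM _))
  let φ : W → V → ℝ := fun w' u => (#{x | IsDeficient G (β (c w')) (truncations H c w') (c w') v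
    (overwrite c (earlier H c w' ∩ P) f (Function.update x (c w) u))} : ℝ)
  let bad : W → Finset V := fun w' => {u | B w' * M (c w) < φ w' u}
  have hMpos : 0 < M (c w) := zero_lt_one.trans_le (hM _)
  have hbad : ∀ w', (#(bad w') : ℝ) ≤ Fintype.card V / M (c w) := by
    intro w'
    rw [le_div_iff₀ hMpos]
    refine card_filter_lt_mul_le (fun u => Nat.cast_nonneg _) (hB w') ?_
    have h := sum_sum_update (V := V) (c w) (fun x => if IsDeficient G (β (c w'))
      (truncations H c w') (c w') v (overwrite c (earlier H c w' ∩ P) f x) then (1 : ℝ) else 0)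
    rw [sum_comm] at h
    simp only [sum_boole, nsmul_eq_mul] at h
    exact h.trans_le (mul_le_mul_of_nonneg_left (hf.card_deficient_le w') (Nat.cast_nonneg _))
  let X : Finset V := P.image f ∪ ({w' | w ∈ earlier H c w'} : Finset W).biUnion bad
  have hX : (#X : ℝ) < #C := by
    have h1 : (#X : ℝ) ≤ #(P.image f) + ∑ w' with w ∈ earlier H c w', (#(bad w') : ℝ) := by
      exact_mod_cast (card_union_le _ _).trans (Nat.add_le_add_left card_biUnion_le _)
    have h2 : (#(P.image f) : ℝ) ≤ Fintype.card W := by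
      exact_mod_cast card_image_le.trans (card_le_univ P)
    have h3 : ∑ w' with w ∈ earlier H c w', (#(bad w') : ℝ) ≤ D * (Fintype.card V / M (c w)) := by
      refine (sum_le_sum fun w' _ => hbad w').trans ?_
      rw [sum_const, nsmul_eq_mul]
      exact mul_le_mul_of_nonneg_right (hD w) (by positivity)
    have h4 : D * (Fintype.card V / M (c w)) = β (c w) * Fintype.card V / 2 := by
      have := hβM (c w)
      field_simp
      linarith
    linarith [hcard (c w)]
  obtain ⟨u, huC, huX⟩ := exists_mem_notMem_of_card_lt_card (Nat.cast_lt.1 hX)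
  have hne : ∀ {Q : Finset W}, Q ⊆ P → ∀ s ∈ Q, f s = Function.update f w u s :=
    fun hQ s hs => (Function.update_of_ne (ne_of_mem_of_not_mem (hQ hs) hw) _ _).symm
  refine ⟨u, ?_, fun e he => ?_, fun w' => ?_⟩
  · rw [coe_insert, Set.injOn_insert (by simpa using hw)]
    refine ⟨hf.injOn.congr fun s hs => hne Subset.rfl s hs, ?_⟩
    rintro ⟨s, hs, h⟩
    rw [Function.update_self, ← hne Subset.rfl s hs] at h
    exact huX (mem_union_left _ (mem_image.2 ⟨s, hs, h⟩))
  · by_cases hwe : w ∈ e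
    · rw [inter_insert_of_mem hwe, overwrite_insert _ (by simp [hw])]
      · exact hCG u huC e he hwe
      · rw [← inter_insert_of_mem hwe]
        exact (injOn_edge hc he).mono (by simp)
    · rw [inter_insert_of_notMem hwe, ← overwrite_congr (hne inter_subset_right)]
      exact hf.overwrite_mem e he
  · by_cases hww : w ∈ earlier H c w'
    · have hinj : Set.InjOn c (insert w (earlier H c w' ∩ P) : Finset W) := by
        rw [← inter_insert_of_mem hww]
        exact (injOn_earlier hc w').mono (by simp)
      have hnot : w ∉ earlier H c w' ∩ P := by simp [hw]
      have hcw : ∀ s ∈ earlier H c w' ∩ P, c s ≠ c w := fun s hs h =>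
        hnot (hinj (mem_insert_of_mem hs) (mem_insert_self _ _) h ▸ hs)
      rw [inter_insert_of_mem hww, prod_insert hnot]
      simp only [overwrite_insert hinj hnot, update_overwrite hcw]
      have hu : ¬ B w' * M (c w) < φ w' u := fun h => huX <| mem_union_right _ <|
        mem_biUnion.2 ⟨w', by simpa using hww, by simpa [bad] using h⟩
      refine (not_lt.1 hu).trans_eq ?_
      simp only [B]
      ring
    · rw [inter_insert_of_notMem hww]
      simp only [← overwrite_congr (hne (inter_subset_right (s₁ := earlier H c w')))]
      exact hf.card_deficient_le w'

theorem IsPartialEmbedding.exists_univ [Nonempty V]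
    (hf : IsPartialEmbedding H c G v β η M ∅ f)
    (hc : ∀ e ∈ H, ∀ e' ∈ H, (e ∩ e').Nonempty → ∀ s ∈ e, ∀ t ∈ e', c s = c t → s = t)
    {D : ℝ} (hD : ∀ w, (#{w' | w ∈ earlier H c w'} : ℝ) ≤ D)
    (hM : ∀ i, 1 ≤ M i) (hβM : ∀ i, β i * M i = 2 * D)
    (hη0 : ∀ i, 0 < η i) (hη : ∀ i, η i * ∏ j ∈ Iio i, M j < 1)
    (hcard : ∀ i, 2 * (Fintype.card W : ℝ) < β i * Fintype.card V) :
    ∃ g, IsPartialEmbedding H c G v β η M univ g := by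
  have key : ∀ m ≤ Fintype.card W, ∃ P : Finset W, #P = m ∧
      (∀ s ∈ P, ∀ t ∉ P, c s ≤ c t) ∧ ∃ g, IsPartialEmbedding H c G v β η M P g := by
    intro m
    induction m with
    | zero => exact fun _ => ⟨∅, rfl, by simp, f, hf⟩
    | succ m ih =>
      intro hm
      obtain ⟨P, hP, hmono, g, hg⟩ := ih (by omega)
      have hne : (Pᶜ).Nonempty := card_pos.1 (by rw [card_compl]; omega)
      obtain ⟨w, hw, hmin⟩ := exists_min_image Pᶜ c hne
      rw [mem_compl] at hw
      obtain ⟨u, hu⟩ := hg.exists_insert hc hD hM hβM hη0 hη hcard hw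
        (fun s hs => by_contra fun h => (hmin s (mem_compl.2 h)).not_gt hs)
        (fun s hs => hmono s hs w hw)
      refine ⟨insert w P, by rw [card_insert_of_notMem hw, hP], fun s hs t ht => ?_, _, hu⟩
      rw [mem_insert, not_or] at ht
      rcases mem_insert.1 hs with rfl | hs
      · exact hmin t (mem_compl.2 ht.2)
      · exact hmono s hs t ht.2
  obtain ⟨P, hP, -, hg⟩ := key _ le_rfl
  rwa [(card_eq_iff_eq_univ P).1 hP] at hg

end Embedding

/-- A rapidly decreasing sequence dominating the products of the inverses of its terms. -/
theorem exists_decreasing_weights (r : ℕ) {D K : ℝ} (hD : 1 ≤ D) (hK : 0 < K) :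
    ∃ β : Fin r → ℝ, (∀ i, 0 < β i) ∧ (∀ i, β i ≤ 1) ∧
      ∀ i, K * β i * ∏ j ∈ Iio i, (2 * D / β j) < 1 := by
  have hD0 : 0 < 2 * D := by linarith
  set q : ℝ := 1 / (K * (2 * D) ^ r + 1) with hq
  have hKD : 0 < K * (2 * D) ^ r := by positivity
  have hq0 : 0 < q := by positivity
  have hq1 : q ≤ 1 := (div_le_one (by positivity)).2 (by linarith)
  have hprod : ∀ m : ℕ, q ^ 2 ^ m * ∏ j ∈ range m, (2 * D / q ^ 2 ^ j) = (2 * D) ^ m * q := by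
    intro m
    induction m with
    | zero => simp
    | succ m ih =>
      have : q ^ 2 ^ m ≠ 0 := by positivity
      rw [prod_range_succ, pow_succ (2 * D), mul_right_comm _ (2 * D), ← ih, pow_succ 2, pow_mul]
      field_simp
  refine ⟨fun i => q ^ 2 ^ (i : ℕ), fun i => by positivity, fun i => pow_le_one₀ hq0.le hq1,
    fun i => ?_⟩
  have hi : ∏ j ∈ Iio i, (2 * D / q ^ 2 ^ (j : ℕ)) = ∏ j ∈ range (i : ℕ), (2 * D / q ^ 2 ^ j) := by
    rw [← Nat.Iio_eq_range, ← Fin.map_valEmbedding_Iio, prod_map]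
    rfl
  rw [hi, mul_assoc, hprod, ← mul_assoc]
  calc K * (2 * D) ^ (i : ℕ) * q ≤ K * (2 * D) ^ r * q := by
        gcongr
        · linarith
        · exact i.2.le
    _ < 1 := by
        rw [hq, mul_one_div, div_lt_one (by positivity)]
        linarith

/-- For all positive integers Δ and k there exists a constant c(Δ,k) such that
every k-uniform hypergraph H with n vertices and maximum degree at most Δ has Ramsey number
r(H) ≤ c(Δ,k)·n, i.e. every 2-colouring of the k-subsets of a vertex set of size N ≥ c(Δ,k)·n
contains a monochromatic copy of H. -/
theorem stmt_0 :
    ∀ Δ k : ℕ, 0 < Δ → 0 < k →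
    ∃ c : ℕ, 0 < c ∧
      ∀ (n : ℕ) (H : Finset (Finset (Fin n))),
        (∀ e ∈ H, e.card = k) →
        (∀ v : Fin n, (H.filter fun e => v ∈ e).card ≤ Δ) →
        ∀ N : ℕ, c * n ≤ N →
          ∀ χ : Finset (Fin N) → Bool,
            ∃ f : Fin n → Fin N, Function.Injective f ∧
              ∃ b : Bool, ∀ e ∈ H, χ (e.image f) = b := by
  intro Δ k hΔ hk
  obtain ⟨r, hr⟩ : ∃ r, r = (Δ * k) * (Δ * k) + 1 := ⟨_, rfl⟩
  obtain ⟨ε, hε, hdense⟩ := exists_dense_homogeneous k r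
  obtain ⟨K, hK_def⟩ : ∃ K : ℝ, K = (Fintype.card (Fin r × Finset (Finset (Fin r))) + 1) / ε :=
    ⟨_, rfl⟩
  have hK : 0 < K := by rw [hK_def]; positivity
  have hD1 : (1 : ℝ) ≤ (Δ * k : ℕ) := by exact_mod_cast Nat.mul_pos hΔ hk
  obtain ⟨β, hβ0, hβ1, hβ⟩ := exists_decreasing_weights r hD1 hK
  have hr0 : 0 < r := hr ▸ Nat.succ_pos _
  obtain ⟨i₀, -, hi₀⟩ := exists_min_image (univ : Finset (Fin r)) β ⟨⟨0, hr0⟩, mem_univ _⟩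
  obtain ⟨c, hc⟩ := exists_nat_gt (2 / β i₀)
  have hc0 : 0 < c := Nat.cast_pos.1 ((div_pos two_pos (hβ0 i₀)).trans hc)
  refine ⟨c, hc0, fun n H hHk hHΔ N hN χ => ?_⟩
  rcases Nat.eq_zero_or_pos n with rfl | hn
  · refine ⟨Fin.elim0, fun a => a.elim0, true, fun e he => ?_⟩
    have := hHk e he
    rw [eq_empty_of_isEmpty e, card_empty] at this
    omega
  have hNpos : 0 < N := (Nat.mul_pos hc0 hn).trans_le hN
  have : Nonempty (Fin N) := ⟨⟨0, hNpos⟩⟩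
  obtain ⟨b, hb⟩ := hdense N hNpos χ
  obtain ⟨col, hcol⟩ := hr ▸ exists_strong_coloring hHk hHΔ
  obtain ⟨G, hG⟩ : ∃ G : Finset (Fin r → Fin N),
      G = ({v | ∀ I : Finset (Fin r), #I = k → χ (I.image v) = b} : Finset (Fin r → Fin N)) :=
    ⟨_, rfl⟩
  have hGcard : ε * Fintype.card (Fin r → Fin N) ≤ #G := by
    rw [hG, Fintype.card_pi_const, Fintype.card_fin, Nat.cast_pow]
    exact hb
  obtain ⟨v, hvG, hv⟩ := exists_backup hε hGcard hβ0
  rw [← hK_def] at hv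
  have hstart : IsPartialEmbedding H col G v β (fun i => K * β i)
      (fun i => 2 * (Δ * k : ℕ) / β i) ∅ (fun _ => ⟨0, hNpos⟩) := by
    refine ⟨by simp, fun e _ => ?_, fun w => ?_⟩
    · rwa [inter_empty, overwrite_empty]
    · rw [inter_empty, prod_empty, mul_one]
      convert hv (col w) (truncations H col w)
      rw [overwrite_empty]
  have hearlier : ∀ w, (#{w' | w ∈ earlier H col w'} : ℝ) ≤ (Δ * k : ℕ) := by
    intro w
    have : ({w' | w ∈ earlier H col w'} : Finset (Fin n)) ⊆ {e ∈ H | w ∈ e}.biUnion id := by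
      intro w' hw'
      obtain ⟨e, he, hw'e, hwe, -⟩ := mem_earlier.1 (mem_filter.1 hw').2
      exact mem_biUnion.2 ⟨e, mem_filter.2 ⟨he, hwe⟩, hw'e⟩
    exact_mod_cast (card_le_card this).trans ((card_biUnion_le_card_mul _ _ k
      fun e he => (hHk e (mem_filter.1 he).1).le).trans (Nat.mul_le_mul_right _ (hHΔ w)))
  obtain ⟨f, hf⟩ := hstart.exists_univ hcol hearlier
    (fun i => by
      rw [one_le_div (hβ0 i)]
      linarith [hβ1 i])
    (fun i => mul_div_cancel₀ _ (hβ0 i).ne')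
    (fun i => mul_pos hK (hβ0 i)) hβ
    (fun i => by
      rw [Fintype.card_fin, Fintype.card_fin]
      have h1 : (c : ℝ) * n ≤ N := by exact_mod_cast hN
      have h2 : 2 < c * β i₀ := (div_lt_iff₀ (hβ0 i₀)).1 hc
      have h3 : (0 : ℝ) < n := Nat.cast_pos.2 hn
      calc 2 * (n : ℝ) < c * β i₀ * n := mul_lt_mul_of_pos_right h2 h3
        _ = β i₀ * (c * n) := by ring
        _ ≤ β i * N := mul_le_mul (hi₀ i (mem_univ _)) h1 (by positivity) (hβ0 i).le)
  refine ⟨f, fun s t h => hf.injOn (by simp) (by simp) h, b, fun e he => ?_⟩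
  have hmem := hf.overwrite_mem e he
  rw [hG, mem_filter] at hmem
  replace hmem := hmem.2 (e.image col)
    (by rw [card_image_of_injOn (injOn_edge hcol he), hHk e he])
  rw [inter_univ, image_image] at hmem
  rwa [image_congr (g := f) (f := overwrite col e f v ∘ col)
    fun s hs => overwrite_apply (injOn_edge hcol he) hs] at hmem
end

section
/- For every integer l ≥ 3 there exists a constant c = c(l) with the following property: if F is an l-uniform l-partite hypergraph with n vertices and maximum degree Δ ≥ 1, and G is an l-uniform l-partite hypergraph with parts of size N and at least ε·N^l edges where 0 < ε ≤ 1, and N ≥ (ε/2)^{-c·Δ^{l-1}}·n, then G contains a copy of F. -/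
open Finset

theorem sum_update_eq_card_mul_sum {V X : Type*} [Fintype V] [DecidableEq V] [Fintype X]
    (u : V) (g : (V → X) → ℝ) :
    ∑ x, ∑ ψ, g (Function.update ψ u x) = Fintype.card X * ∑ ψ, g ψ := by
  have h : ∑ q : X × (V → X), g (Function.update q.2 u q.1) = ∑ q : X × (V → X), g q.2 :=
    Finset.sum_bij' (fun q _ => (q.2 u, Function.update q.2 u q.1))
      (fun q _ => (q.2 u, Function.update q.2 u q.1)) (by simp) (by simp) (by simp) (by simp)
      (by simp)
  rw [Fintype.sum_prod_type, Fintype.sum_prod_type] at h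
  rw [h]
  simp

theorem sum_comp_injective {L V X : Type*} [Fintype L] [Fintype V] [DecidableEq V] [DecidableEq L]
    [Fintype X] {ι : L → V} (hι : Function.Injective ι) (g : (L → X) → ℝ) :
    (∑ ψ : V → X, g (ψ ∘ ι)) * (Fintype.card X : ℝ) ^ Fintype.card L =
      (∑ χ, g χ) * (Fintype.card X : ℝ) ^ Fintype.card V := by
  classical
  let e : L ⊕ ↥((Set.range ι)ᶜ) ≃ V :=
    (Equiv.sumCongr (Equiv.ofInjective ι hι) (Equiv.refl _)).trans (Equiv.Set.sumCompl _)
  have he : ∀ a, e (Sum.inl a) = ι a := fun a => by simp [e]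
  have hc : Fintype.card V = Fintype.card L + Fintype.card ↥((Set.range ι)ᶜ) := by
    rw [← Fintype.card_congr e, Fintype.card_sum]
  have h1 : ∑ ψ : V → X, g (ψ ∘ ι) =
      ∑ q : (L → X) × (↥((Set.range ι)ᶜ) → X), g q.1 := by
    refine Fintype.sum_equiv ((Equiv.arrowCongr e.symm (Equiv.refl X)).trans
      (Equiv.sumArrowEquivProdArrow _ _ _)) _ _ fun ψ => ?_
    congr 1
  rw [h1, Fintype.sum_prod_type, hc, pow_add]
  simp only [sum_const, card_univ, Fintype.card_fun, nsmul_eq_mul, Nat.cast_pow, ← mul_sum]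
  ring

/-- The values of the coordinate `i` which move every tuple of `B` into `G`. -/
def extensions {l : ℕ} {X : Type*} [Fintype X] [DecidableEq X] (G : Finset (Fin l → X))
    (i : Fin l) (B : Finset (Fin l → X)) : Finset X :=
  {t | ∀ b ∈ B, Function.update b i t ∈ G}

/-- `B` lies in `G'` but has fewer than `β` extensions into `G` in the coordinate `i`. -/
def IsThin {l : ℕ} {X : Type*} [Fintype X] [DecidableEq X] (G G' : Finset (Fin l → X))
    (i : Fin l) (β : ℝ) (B : Finset (Fin l → X)) : Prop :=
  B ⊆ G' ∧ (#(extensions G i B) : ℝ) < β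

noncomputable instance {l : ℕ} {X : Type*} [Fintype X] [DecidableEq X]
    (G G' : Finset (Fin l → X)) (i : Fin l) (β : ℝ) (B : Finset (Fin l → X)) :
    Decidable (IsThin G G' i β B) :=
  inferInstanceAs (Decidable (_ ∧ _))

/-- The tuples which stay in `G` when their coordinate `i` is replaced by any entry of `T`. -/
def linkOf {l s : ℕ} {X : Type*} [Fintype X] [DecidableEq X] (G : Finset (Fin l → X))
    (i : Fin l) (T : Fin s → X) : Finset (Fin l → X) :=
  {x | ∀ j, Function.update x i (T j) ∈ G}

section DependentRandomChoice

variable {l : ℕ} {X : Type*} [Fintype X] [DecidableEq X]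

theorem card_filter_forall_mem {s : ℕ} (C : Finset X) :
    #{T : Fin s → X | ∀ j, T j ∈ C} = #C ^ s := by
  have : ({T : Fin s → X | ∀ j, T j ∈ C} : Finset _) = Fintype.piFinset fun _ => C := by
    ext; simp
  rw [this, Fintype.card_piFinset_const]

theorem sum_card_linkOf_ge (G : Finset (Fin l → X)) (i : Fin l) (s : ℕ) (hs : 0 < s) {d : ℝ}
    (hd : 0 ≤ d) (hX : 0 < Fintype.card X) (hG : d * (Fintype.card X : ℝ) ^ l ≤ #G) :
    d ^ s * (Fintype.card X : ℝ) ^ l * (Fintype.card X : ℝ) ^ s ≤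
      ∑ T : Fin s → X, (#(linkOf G i T) : ℝ) := by
  have hX' : (0 : ℝ) < Fintype.card X := by exact_mod_cast hX
  have h1 : ∑ T : Fin s → X, (#(linkOf G i T) : ℝ) =
      ∑ x : Fin l → X, (#{t | Function.update x i t ∈ G} : ℝ) ^ s := by
    norm_cast
    have h : ∀ x : Fin l → X, #{t | Function.update x i t ∈ G} ^ s =
        #{T : Fin s → X | ∀ j, Function.update x i (T j) ∈ G} := fun x => by
      rw [← card_filter_forall_mem]
      simp
    rw [sum_congr rfl fun x _ => h x]
    simp only [linkOf, card_filter]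
    rw [sum_comm]
  have h2 : ∑ x : Fin l → X, (#{t | Function.update x i t ∈ G} : ℝ) =
      Fintype.card X * #G := by
    have := sum_update_eq_card_mul_sum (X := X) i (fun x => if x ∈ G then (1 : ℝ) else 0)
    rw [sum_comm] at this
    simpa using this
  obtain ⟨k, rfl⟩ : ∃ k, s = k + 1 := ⟨s - 1, by omega⟩
  rw [h1]
  refine le_trans ?_ (pow_sum_div_card_le_sum_pow (fun _ _ => by positivity) k)
  rw [h2, card_univ, Fintype.card_fun, Fintype.card_fin, le_div_iff₀ (by positivity)]
  push_cast
  calc _ = (Fintype.card X * (d * (Fintype.card X : ℝ) ^ l)) ^ (k + 1) := by ring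
    _ ≤ _ := by gcongr

theorem sum_card_isThin_le (G : Finset (Fin l → X)) (i : Fin l) (s : ℕ) {m : ℕ} {β : ℝ}
    (hβ : 0 ≤ β) (A : Finset (Fin l → Fin m)) :
    ∑ T : Fin s → X,
      (#{χ : Fin m → X | IsThin G (linkOf G i T) i β (A.image (χ ∘ ·))} : ℝ) ≤
      β ^ s * (Fintype.card X : ℝ) ^ m := by
  have h1 : ∑ T : Fin s → X,
      (#{χ : Fin m → X | IsThin G (linkOf G i T) i β (A.image (χ ∘ ·))} : ℝ) =
      ∑ χ : Fin m → X,
        (#{T : Fin s → X | IsThin G (linkOf G i T) i β (A.image (χ ∘ ·))} : ℝ) := by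
    norm_cast
    simp_rw [card_filter]
    rw [sum_comm]
  have h2 : ∀ χ : Fin m → X,
      (#{T : Fin s → X | IsThin G (linkOf G i T) i β (A.image (χ ∘ ·))} : ℝ) ≤ β ^ s := by
    intro χ
    by_cases hc : (#(extensions G i (A.image (χ ∘ ·))) : ℝ) < β
    · refine le_trans ?_ (pow_le_pow_left₀ (by positivity) hc.le s)
      norm_cast
      rw [← card_filter_forall_mem]
      refine card_le_card fun T hT => ?_
      have hT' := (mem_filter.1 hT).2.1
      simp only [mem_filter, mem_univ, true_and, extensions]
      intro j b hb
      exact (mem_filter.1 (hT' hb)).2 j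
    · simp only [IsThin, hc, and_false, filter_false, card_empty, Nat.cast_zero]
      positivity
  rw [h1]
  refine (sum_le_sum fun χ _ => h2 χ).trans ?_
  simp [mul_comm]

theorem exists_dense_few_isThin (G : Finset (Fin l → X)) (i : Fin l) (s m : ℕ) (hs : 0 < s)
    {d β : ℝ} (hd : 0 < d) (hβ : 0 < β) (hX : 0 < Fintype.card X)
    (hdep : DependsOn (· ∈ G) {j : Fin l | (j : ℕ) < i + 1})
    (hG : d * (Fintype.card X : ℝ) ^ l ≤ #G) :
    ∃ G' : Finset (Fin l → X), DependsOn (· ∈ G') {j : Fin l | (j : ℕ) < i} ∧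
      d ^ s / 2 * (Fintype.card X : ℝ) ^ l ≤ #G' ∧
      ∀ A : Finset (Fin l → Fin m),
        (#{χ : Fin m → X | IsThin G G' i (β * Fintype.card X) (A.image (χ ∘ ·))} : ℝ) ≤
          2 * 2 ^ (m ^ l) * (β / d) ^ s * (Fintype.card X : ℝ) ^ m := by
  have hX' : (0 : ℝ) < Fintype.card X := by exact_mod_cast hX
  set N : ℝ := (Fintype.card X : ℝ) with hN
  let bad (T : Fin s → X) : ℝ := ∑ A : Finset (Fin l → Fin m),
    (#{χ : Fin m → X | IsThin G (linkOf G i T) i (β * N) (A.image (χ ∘ ·))} : ℝ)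
  have hbad : ∑ T, bad T ≤ 2 ^ (m ^ l) * ((β * N) ^ s * N ^ m) := by
    simp only [bad]
    rw [sum_comm]
    refine (sum_le_sum fun A _ => sum_card_isThin_le G i s (by positivity) A).trans ?_
    simp [Fintype.card_finset, hN]
  set c : ℝ := d ^ s * N ^ l / (2 * 2 ^ (m ^ l) * β ^ s * N ^ m) with hc
  have hc0 : 0 < c := by positivity
  have hsum : ∑ _T : Fin s → X, d ^ s / 2 * N ^ l ≤
      ∑ T : Fin s → X, ((#(linkOf G i T) : ℝ) - c * bad T) := by
    have h1 := sum_card_linkOf_ge G i s hs hd.le hX hG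
    have h2 := mul_le_mul_of_nonneg_left hbad hc0.le
    have h3 : c * (2 ^ (m ^ l) * ((β * N) ^ s * N ^ m)) = d ^ s / 2 * N ^ l * N ^ s := by
      rw [hc, mul_pow]; field_simp
    simp only [sum_sub_distrib, ← mul_sum, sum_const, card_univ, Fintype.card_fun, Fintype.card_fin, nsmul_eq_mul,
      Nat.cast_pow]
    rw [← hN] at h1 ⊢
    linarith
  have : Nonempty X := Fintype.card_pos_iff.1 hX
  obtain ⟨T, -, hT⟩ := exists_le_of_sum_le univ_nonempty hsum
  have hb0 : 0 ≤ bad T := sum_nonneg fun _ _ => by positivity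
  refine ⟨linkOf G i T, ?_, ?_, fun A => ?_⟩
  · intro x y hxy
    simp only [linkOf, mem_filter, mem_univ, true_and, eq_iff_iff]
    refine forall_congr' fun j => ?_
    refine iff_of_eq (hdep fun k hk => ?_)
    by_cases h : k = i
    · subst h; simp
    · have : (k : ℕ) ≠ i := fun h' => h (Fin.ext h')
      have hk' : (k : ℕ) < i + 1 := hk
      simp only [Function.update_of_ne h]
      exact hxy k (show (k : ℕ) < i by omega)
  · have := mul_nonneg hc0.le hb0
    linarith
  · have hle : (#(linkOf G i T) : ℝ) ≤ N ^ l := by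
      rw [hN]
      exact_mod_cast (card_le_univ _).trans (by simp)
    have h1 : c * bad T ≤ N ^ l := by
      have : 0 ≤ d ^ s / 2 * N ^ l := by positivity
      linarith
    have h2 : bad T ≤ 2 * 2 ^ (m ^ l) * (β / d) ^ s * N ^ m := by
      rw [← le_div_iff₀' hc0] at h1
      refine h1.trans_eq ?_
      rw [hc, div_pow]; field_simp
    refine le_trans ?_ h2
    exact single_le_sum (f := fun A : Finset (Fin l → Fin m) =>
      (#{χ : Fin m → X | IsThin G (linkOf G i T) i (β * N) (A.image (χ ∘ ·))} : ℝ))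
      (fun _ _ => by positivity) (mem_univ A)

end DependentRandomChoice

theorem exists_chain {l : ℕ} {X : Type*} [Fintype X] [DecidableEq X] {s m : ℕ} (hs : 2 ≤ s)
    (hX : 0 < Fintype.card X) {η β δ : ℝ} (hη : 0 < η) (hη1 : η ≤ 1) (hβ : 0 < β)
    (hδ : 2 * 2 ^ (m ^ l) * (β / η ^ (s ^ (l - 1))) ^ s ≤ δ) (k : ℕ) (hk : k ≤ l)
    (G : Finset (Fin l → X)) (hdep : DependsOn (· ∈ G) {j : Fin l | (j : ℕ) < k})
    (hG : 2 * η ^ (s ^ (l - k)) * (Fintype.card X : ℝ) ^ l ≤ #G) :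
    ∃ H : ℕ → Finset (Fin l → X), H k = G ∧
      (∀ j ≤ k, DependsOn (· ∈ H j) {i : Fin l | (i : ℕ) < j} ∧
        2 * η ^ (s ^ (l - j)) * (Fintype.card X : ℝ) ^ l ≤ #(H j)) ∧
      ∀ i : Fin l, (i : ℕ) < k → ∀ A : Finset (Fin l → Fin m),
        (#{χ : Fin m → X | IsThin (H (i + 1)) (H i) i (β * Fintype.card X)
          (A.image (χ ∘ ·))} : ℝ) ≤ δ * (Fintype.card X : ℝ) ^ m := by
  induction k generalizing G with
  | zero => exact ⟨fun _ => G, rfl, fun j hj => by obtain rfl : j = 0 := by omega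
                                                   exact ⟨hdep, hG⟩, by simp⟩
  | succ k ih =>
    obtain ⟨G', hdep', hG', hthin⟩ := exists_dense_few_isThin G ⟨k, hk⟩ s m (by omega)
      (by positivity : 0 < 2 * η ^ (s ^ (l - (k + 1)))) hβ hX hdep hG
    have hdens : 2 * η ^ (s ^ (l - k)) * (Fintype.card X : ℝ) ^ l ≤ #G' := by
      refine le_trans ?_ hG'
      have he : s ^ (l - k) = s ^ (l - (k + 1)) * s := by
        rw [← pow_succ]; congr 1; omega
      rw [mul_pow, ← pow_mul, ← he]
      have h4 : (2 : ℝ) ^ 2 ≤ 2 ^ s := pow_le_pow_right₀ (by norm_num) hs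
      gcongr
      have := pow_pos hη (s ^ (l - k))
      nlinarith
    obtain ⟨H, hHk, hH, hHthin⟩ := ih (by omega) G' hdep' hdens
    refine ⟨Function.update H (k + 1) G, by simp, fun j hj => ?_, fun i hi A => ?_⟩
    · obtain rfl | hj' := hj.eq_or_lt
      · rw [Function.update_self]
        exact ⟨hdep, hG⟩
      · rw [Function.update_of_ne hj'.ne]
        exact hH j (by omega)
    · rw [Function.update_of_ne (a := (i : ℕ)) (by omega)]
      obtain hik | hik := (Nat.lt_succ_iff.1 hi).eq_or_lt
      · obtain rfl : i = ⟨k, hk⟩ := Fin.ext hik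
        simp only [Function.update_self, hHk]
        refine (hthin A).trans (mul_le_mul_of_nonneg_right (le_trans ?_ hδ) (by positivity))
        gcongr
        have h1 : η ^ (s ^ (l - 1)) ≤ η ^ (s ^ (l - (k + 1))) :=
          pow_le_pow_of_le_one hη.le hη1 (Nat.pow_le_pow_right (by omega) (by omega))
        have := pow_pos hη (s ^ (l - (k + 1)))
        linarith
      · rw [Function.update_of_ne (by omega)]
        exact hHthin i hik A

section Embedding

variable {l : ℕ} {V X : Type*} [DecidableEq V]

/-- The number of maps `ψ` with `D ψ` after overwriting `ψ` by `φ` on `S`. -/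
def completionCount [Fintype V] [Fintype X] (D : (V → X) → Prop) [DecidablePred D] (S : Finset V) (φ : V → X) : ℕ :=
  #{ψ : V → X | D (S.piecewise φ ψ)}

theorem piecewise_insert_update {S : Finset V} {u : V} (hu : u ∉ S) (φ ψ : V → X) (x : X) :
    (insert u S).piecewise (Function.update φ u x) ψ =
      S.piecewise φ (Function.update ψ u x) := by
  ext w
  by_cases hw : w = u
  · subst hw; simp [hu]
  · by_cases hS : w ∈ S <;> simp [Finset.piecewise, hw, hS]

theorem sum_completionCount_insert [Fintype V] [Fintype X] (D : (V → X) → Prop)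
    [DecidablePred D] {S : Finset V} {u : V} (hu : u ∉ S) (φ : V → X) :
    ∑ x, (completionCount D (insert u S) (Function.update φ u x) : ℝ) =
      Fintype.card X * completionCount D S φ := by
  have h := sum_update_eq_card_mul_sum u
    fun ψ => if D (S.piecewise φ ψ) then (1 : ℝ) else 0
  simp only [completionCount, piecewise_insert_update hu]
  simpa using h

theorem completionCount_insert_of_dependsOn [Fintype V] [Fintype X] (D : (V → X) → Prop)
    [DecidablePred D] {S L : Finset V} (hD : DependsOn D L) {u : V} (hu : u ∉ S) (huL : u ∉ L) (φ : V → X) (x : X) :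
    completionCount D (insert u S) (Function.update φ u x) = completionCount D S φ := by
  unfold completionCount
  congr 1
  refine filter_congr fun ψ _ => ?_
  rw [piecewise_insert_update hu]
  refine iff_of_eq (hD fun w hw => ?_)
  have hwu : w ≠ u := fun h => huL (h ▸ hw)
  by_cases hS : w ∈ S <;> simp [hS, hwu]

theorem card_filter_mul_lt_le [Fintype V] [Fintype X] (D : (V → X) → Prop)
    [DecidablePred D] {S : Finset V} {u : V} (hu : u ∉ S) (φ : V → X) {B K : ℝ} (hB : 0 < B) (hK : 0 < K)
    (h : (completionCount D S φ : ℝ) ≤ B) :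
    (#{x | K * B < (completionCount D (insert u S) (Function.update φ u x) : ℝ)} : ℝ) ≤
      Fintype.card X / K := by
  rw [le_div_iff₀ hK]
  refine le_of_mul_le_mul_right ?_ hB
  calc _ = ∑ x with K * B < (completionCount D (insert u S) (Function.update φ u x) : ℝ),
        K * B := by simp; ring
    _ ≤ ∑ x with K * B < (completionCount D (insert u S) (Function.update φ u x) : ℝ),
        (completionCount D (insert u S) (Function.update φ u x) : ℝ) :=
      sum_le_sum fun x hx => (mem_filter.1 hx).2.le
    _ ≤ ∑ x, (completionCount D (insert u S) (Function.update φ u x) : ℝ) :=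
      sum_le_sum_of_subset_of_nonneg (subset_univ _) fun _ _ _ => by positivity
    _ = Fintype.card X * completionCount D S φ := sum_completionCount_insert D hu φ
    _ ≤ _ := by gcongr

/-- The edges of `E` through `v`, an edge being the tuple of its vertices ordered by parts. -/
def edgesAt (p : V → Fin l) (E : Finset (Fin l → V)) (v : V) : Finset (Fin l → V) :=
  {a ∈ E | a (p v) = v}

/-- The vertices in earlier parts than `v` which share an edge with `v`. -/
def earlierNeighbors (p : V → Fin l) (E : Finset (Fin l → V)) (v : V) : Finset V :=
  (edgesAt p E v).biUnion fun a => (univ.filter (· < p v)).image a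

theorem mem_earlierNeighbors {p : V → Fin l} {E : Finset (Fin l → V)} {u v : V} :
    u ∈ earlierNeighbors p E v ↔ ∃ a ∈ edgesAt p E v, ∃ j < p v, a j = u := by
  simp [earlierNeighbors]

theorem card_earlierNeighbors_le {p : V → Fin l} {E : Finset (Fin l → V)} {v : V} {Δ : ℕ}
    (h : #(edgesAt p E v) ≤ Δ) : #(earlierNeighbors p E v) ≤ l * Δ := by
  refine (card_biUnion_le_card_mul _ _ l fun a _ => ?_).trans
    ((Nat.mul_le_mul_right l h).trans_eq (mul_comm _ _))
  exact card_image_le.trans ((card_filter_le _ _).trans (by simp))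

theorem card_mem_earlierNeighbors_le [Fintype V] {p : V → Fin l} {E : Finset (Fin l → V)} {Δ : ℕ}
    (hE : ∀ a ∈ E, ∀ j, p (a j) = j) (h : ∀ v, #(edgesAt p E v) ≤ Δ) (u : V) :
    #{v | u ∈ earlierNeighbors p E v} ≤ l * Δ := by
  have hsub : ({v | u ∈ earlierNeighbors p E v} : Finset V) ⊆
      (edgesAt p E u).biUnion fun a => univ.image a := by
    intro v hv
    obtain ⟨a, ha, j, -, rfl⟩ := mem_earlierNeighbors.1 (mem_filter.1 hv).2
    obtain ⟨haE, hav⟩ := mem_filter.1 ha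
    refine mem_biUnion.2 ⟨a, mem_filter.2 ⟨haE, by rw [hE a haE]⟩, ?_⟩
    exact mem_image.2 ⟨p v, mem_univ _, hav⟩
  refine (card_le_card hsub).trans ((card_biUnion_le_card_mul _ _ l fun a _ => ?_).trans
    ((Nat.mul_le_mul_right l (h u)).trans_eq (mul_comm _ _)))
  exact card_image_le.trans (by simp)

/-- The images under `ψ` of the edges through `v` are thin with respect to the chain `H`. -/
abbrev ThinAt [Fintype X] [DecidableEq X] (p : V → Fin l) (E : Finset (Fin l → V))
    (H : ℕ → Finset (Fin l → X)) (b : ℝ) (v : V) (ψ : V → X) : Prop :=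
  IsThin (H (p v + 1)) (H (p v)) (p v) b ((edgesAt p E v).image (ψ ∘ ·))

theorem dependsOn_thinAt [Fintype X] [DecidableEq X] {p : V → Fin l} {E : Finset (Fin l → V)}
    {H : ℕ → Finset (Fin l → X)} (b : ℝ)
    (hdep : ∀ k ≤ l, DependsOn (· ∈ H k) {i : Fin l | (i : ℕ) < k}) (v : V) :
    DependsOn (ThinAt p E H b v) (earlierNeighbors p E v : Set V) := by
  intro ψ ψ' h
  have hag : ∀ a ∈ edgesAt p E v, ∀ j < p v, ψ (a j) = ψ' (a j) := fun a ha j hj =>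
    h _ (mem_earlierNeighbors.2 ⟨a, ha, j, hj, rfl⟩)
  have hsub : (edgesAt p E v).image (ψ ∘ ·) ⊆ H (p v) ↔
      (edgesAt p E v).image (ψ' ∘ ·) ⊆ H (p v) := by
    simp only [image_subset_iff]
    exact forall₂_congr fun a ha => iff_of_eq (hdep _ (p v).2.le fun j hj => hag a ha j hj)
  have hext : extensions (H (p v + 1)) (p v) ((edgesAt p E v).image (ψ ∘ ·)) =
      extensions (H (p v + 1)) (p v) ((edgesAt p E v).image (ψ' ∘ ·)) := by
    ext t
    simp only [extensions, mem_filter, mem_univ, true_and, forall_mem_image]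
    refine forall₂_congr fun a ha => iff_of_eq (hdep _ (p v).2 fun j hj => ?_)
    by_cases hjv : j = p v
    · subst hjv; simp
    · simp only [Function.update_of_ne hjv]
      refine hag a ha j (Fin.lt_def.2 ?_)
      have h1 : (j : ℕ) < p v + 1 := hj
      have h2 : (j : ℕ) ≠ p v := fun h => hjv (Fin.ext h)
      omega
  simp only [ThinAt, IsThin, hsub, hext]

/-- A map defined so far on `S`, a union of initial parts and some vertices of the next one, which
is injective, respects the chain `H` and leaves every vertex unlikely to become thin. -/
structure IsPartialEmbedding_s1 [Fintype V] [Fintype X] [DecidableEq X] (p : V → Fin l)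
    (E : Finset (Fin l → V)) (H : ℕ → Finset (Fin l → X)) (b δ K : ℝ) (S : Finset V)
    (φ : V → X) : Prop where
  le_of_notMem : ∀ w ∉ S, ∀ u ∈ S, p u ≤ p w
  injOn : Set.InjOn φ S
  mem : ∀ a ∈ E, ∀ k ≤ l, (∀ j : Fin l, (j : ℕ) < k → a j ∈ S) → φ ∘ a ∈ H k
  count_le : ∀ v, (completionCount (ThinAt p E H b v) S φ : ℝ) ≤
    δ * K ^ #(S ∩ earlierNeighbors p E v) * (Fintype.card X : ℝ) ^ Fintype.card V

theorem le_card_extensions [Fintype V] [Fintype X] [DecidableEq X] {p : V → Fin l}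
    {E : Finset (Fin l → V)} {H : ℕ → Finset (Fin l → X)} {b δ K : ℝ} {m : ℕ} {S : Finset V}
    {φ : V → X} (hX : 0 < Fintype.card X)
    (hdep : ∀ k ≤ l, DependsOn (· ∈ H k) {i : Fin l | (i : ℕ) < k})
    (hm : ∀ v, #(earlierNeighbors p E v) ≤ m) (hδ0 : 0 < δ) (hK : 1 ≤ K) (hδ : δ * K ^ m < 1)
    (h : IsPartialEmbedding_s1 p E H b δ K S φ) {u : V} (hu : earlierNeighbors p E u ⊆ S) :
    b ≤ #(extensions (H (p u + 1)) (p u) ((edgesAt p E u).image (φ ∘ ·))) := by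
  have hX' : (0 : ℝ) < Fintype.card X := by exact_mod_cast hX
  have hdepS : ∀ ψ, ThinAt p E H b u (S.piecewise φ ψ) = ThinAt p E H b u φ := fun ψ =>
    dependsOn_thinAt b hdep u fun w hw => by simp [hu hw]
  have hnot : ¬ ThinAt p E H b u φ := by
    intro hthin
    have h1 := h.count_le u
    simp only [completionCount, hdepS, hthin, filter_true, card_univ, Fintype.card_fun,
      Nat.cast_pow] at h1
    have h2 : δ * K ^ #(S ∩ earlierNeighbors p E u) ≤ δ * K ^ m := by
      gcongr
      exact (card_le_card inter_subset_right).trans (hm u)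
    have h3 : (0 : ℝ) < (Fintype.card X : ℝ) ^ Fintype.card V := by positivity
    nlinarith
  by_contra hlt
  refine hnot ⟨?_, not_le.1 hlt⟩
  rw [image_subset_iff]
  intro a ha
  exact h.mem a (mem_filter.1 ha).1 _ (p u).2.le fun j hj =>
    hu (mem_earlierNeighbors.2 ⟨a, ha, j, hj, rfl⟩)

theorem IsPartialEmbedding_s1.extend [Fintype V] [Fintype X] [DecidableEq X] {p : V → Fin l}
    {E : Finset (Fin l → V)} {H : ℕ → Finset (Fin l → X)} {b δ K : ℝ} {S : Finset V}
    {φ : V → X} (hE : ∀ a ∈ E, ∀ j, p (a j) = j)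
    (hdep : ∀ k ≤ l, DependsOn (· ∈ H k) {i : Fin l | (i : ℕ) < k})
    (h : IsPartialEmbedding_s1 p E H b δ K S φ) {u : V} (hu : u ∉ S)
    (hmin : ∀ w ∉ S, p u ≤ p w) {x : X}
    (hx : x ∈ extensions (H (p u + 1)) (p u) ((edgesAt p E u).image (φ ∘ ·)))
    (hxS : x ∉ S.image φ)
    (hcount : ∀ v, u ∈ earlierNeighbors p E v →
      (completionCount (ThinAt p E H b v) (insert u S) (Function.update φ u x) : ℝ) ≤
        K * (δ * K ^ #(S ∩ earlierNeighbors p E v) *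
          (Fintype.card X : ℝ) ^ Fintype.card V)) :
    IsPartialEmbedding_s1 p E H b δ K (insert u S) (Function.update φ u x) where
  le_of_notMem w hw v hv := by
    rw [mem_insert, not_or] at hw
    obtain rfl | hv := mem_insert.1 hv
    · exact hmin w hw.2
    · exact h.le_of_notMem w hw.2 v hv
  injOn := by
    have hne : ∀ w ∈ S, w ≠ u := fun w hw hwu => hu (hwu ▸ hw)
    rw [coe_insert, Set.injOn_insert (by simpa using hu)]
    refine ⟨fun v hv w hw hvw => ?_, ?_⟩
    · rw [Function.update_of_ne (hne v hv), Function.update_of_ne (hne w hw)] at hvw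
      exact h.injOn hv hw hvw
    · rintro ⟨w, hw, hwx⟩
      rw [Function.update_self, Function.update_of_ne (hne w hw)] at hwx
      exact hxS (mem_image.2 ⟨w, hw, hwx⟩)
  mem a ha k hk hak := by
    by_cases hau : ∃ j : Fin l, (j : ℕ) < k ∧ a j = u
    · obtain ⟨j, hjk, rfl⟩ := hau
      have hj : p (a j) = j := hE a ha j
      rw [hj] at hx
      have hne : ∀ i, i ≠ j → a i ≠ a j := fun i hij he =>
        hij ((hE a ha i).symm.trans ((congrArg p he).trans hj))
      obtain rfl : k = j + 1 := by
        by_contra hkj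
        have hlt : (j : ℕ) + 1 < k := by omega
        have hmem := hak ⟨j + 1, by omega⟩ hlt
        have hmem' := (mem_insert.1 hmem).resolve_left (hne _ fun h => by
          simpa using congrArg Fin.val h)
        have := h.le_of_notMem _ hu _ hmem'
        rw [hj, hE a ha, Fin.le_def] at this
        simp at this
      have hxa := (mem_filter.1 hx).2 (φ ∘ a)
        (mem_image_of_mem _ (mem_filter.2 ⟨ha, by rw [hj]⟩))
      convert hxa using 1
      ext i
      by_cases hij : i = j
      · subst hij; simp
      · simp [hij, hne i hij]
    · push Not at hau
      have hS : φ ∘ a ∈ H k := h.mem a ha k hk fun j hj =>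
        (mem_insert.1 (hak j hj)).resolve_left (hau j hj)
      refine (hdep k hk (fun j hj => ?_ : ∀ j ∈ {i : Fin l | (i : ℕ) < k},
        (φ ∘ a) j = (Function.update φ u x ∘ a) j)).mp hS
      simp [hau j hj]
  count_le v := by
    by_cases huv : u ∈ earlierNeighbors p E v
    · refine (hcount v huv).trans_eq ?_
      rw [insert_inter_of_mem huv, card_insert_of_notMem fun h => hu (mem_inter.1 h).1]
      ring
    · rw [completionCount_insert_of_dependsOn _ (dependsOn_thinAt b hdep v) hu huv,
        insert_inter_of_notMem huv]
      exact h.count_le v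

theorem IsPartialEmbedding_s1.exists_extend [Fintype V] [Fintype X] [DecidableEq X]
    {p : V → Fin l} {E : Finset (Fin l → V)} {H : ℕ → Finset (Fin l → X)} {b δ K : ℝ} {m : ℕ}
    {S : Finset V} {φ : V → X} (hX : 0 < Fintype.card X) (hE : ∀ a ∈ E, ∀ j, p (a j) = j)
    (hdep : ∀ k ≤ l, DependsOn (· ∈ H k) {i : Fin l | (i : ℕ) < k})
    (hm : ∀ v, #(earlierNeighbors p E v) ≤ m)
    (hm' : ∀ u, #{v | u ∈ earlierNeighbors p E v} ≤ m)
    (hδ0 : 0 < δ) (hK : 1 ≤ K) (hδ : δ * K ^ m < 1)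
    (hb : Fintype.card V + m * (Fintype.card X / K) < b)
    (h : IsPartialEmbedding_s1 p E H b δ K S φ) (hS : S ≠ univ) :
    ∃ u ∉ S, ∃ x, IsPartialEmbedding_s1 p E H b δ K (insert u S) (Function.update φ u x) := by
  have hX' : (0 : ℝ) < Fintype.card X := by exact_mod_cast hX
  have hne : (Sᶜ).Nonempty := by rwa [nonempty_iff_ne_empty, Ne, compl_eq_empty_iff]
  obtain ⟨u, hu, hmin⟩ := exists_min_image Sᶜ p hne
  rw [mem_compl] at hu
  have hmin' : ∀ w ∉ S, p u ≤ p w := fun w hw => hmin w (mem_compl.2 hw)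
  have huS : earlierNeighbors p E u ⊆ S := by
    intro w hw
    obtain ⟨a, ha, j, hj, rfl⟩ := mem_earlierNeighbors.1 hw
    by_contra hwS
    have := hmin' _ hwS
    rw [hE a (mem_filter.1 ha).1] at this
    exact absurd hj (not_lt.2 this)
  have hext := le_card_extensions hX hdep hm hδ0 hK hδ h huS
  let B (v : V) : ℝ := δ * K ^ #(S ∩ earlierNeighbors p E v) *
    (Fintype.card X : ℝ) ^ Fintype.card V
  let bad (v : V) : Finset X := {x | K * B v <
    (completionCount (ThinAt p E H b v) (insert u S) (Function.update φ u x) : ℝ)}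
  have hbad : ∀ v, (#(bad v) : ℝ) ≤ Fintype.card X / K := fun v =>
    card_filter_mul_lt_le _ hu φ (by positivity) (by positivity) (h.count_le v)
  let forbidden := S.image φ ∪ ({v | u ∈ earlierNeighbors p E v} : Finset V).biUnion bad
  have hforb : (#forbidden : ℝ) < b := by
    refine lt_of_le_of_lt ?_ hb
    refine (Nat.cast_le.2 (card_union_le _ _)).trans ?_
    push_cast
    refine add_le_add (Nat.cast_le.2 (card_image_le.trans (card_le_univ _))) ?_
    refine (Nat.cast_le.2 card_biUnion_le).trans ?_
    push_cast
    refine (sum_le_card_nsmul _ _ _ fun v _ => hbad v).trans ?_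
    rw [nsmul_eq_mul]
    gcongr
    exact hm' u
  obtain ⟨x, hx, hxf⟩ := exists_mem_notMem_of_card_lt_card
    (Nat.cast_lt.1 (hforb.trans_le hext))
  rw [mem_union, not_or] at hxf
  refine ⟨u, hu, x, h.extend hE hdep hu hmin' hx hxf.1 fun v huv => ?_⟩
  by_contra hlt
  exact hxf.2 (mem_biUnion.2 ⟨v, by simpa using huv,
    mem_filter.2 ⟨mem_univ _, not_le.1 hlt⟩⟩)

theorem exists_embedding [Fintype V] [Fintype X] [DecidableEq X]
    {p : V → Fin l} {E : Finset (Fin l → V)} {H : ℕ → Finset (Fin l → X)} {b δ K : ℝ} {m : ℕ}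
    (hX : 0 < Fintype.card X) (hE : ∀ a ∈ E, ∀ j, p (a j) = j)
    (hdep : ∀ k ≤ l, DependsOn (· ∈ H k) {i : Fin l | (i : ℕ) < k})
    (hH0 : (H 0).Nonempty)
    (hm : ∀ v, #(earlierNeighbors p E v) ≤ m)
    (hm' : ∀ u, #{v | u ∈ earlierNeighbors p E v} ≤ m)
    (hδ0 : 0 < δ) (hK : 1 ≤ K) (hδ : δ * K ^ m < 1)
    (hb : Fintype.card V + m * (Fintype.card X / K) < b)
    (hthin : ∀ v, (#{ψ | ThinAt p E H b v ψ} : ℝ) ≤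
      δ * (Fintype.card X : ℝ) ^ Fintype.card V) :
    ∃ φ : V → X, Function.Injective φ ∧ ∀ a ∈ E, φ ∘ a ∈ H l := by
  have key : ∀ r ≤ Fintype.card V, ∃ S φ, #S = r ∧ IsPartialEmbedding_s1 p E H b δ K S φ := by
    intro r
    induction r with
    | zero =>
      intro _
      obtain ⟨x₀⟩ := Fintype.card_pos_iff.1 hX
      obtain ⟨y, hy⟩ := hH0
      refine ⟨∅, fun _ => x₀, rfl, by simp, by simp, fun a _ k hk hak => ?_, fun v => ?_⟩
      · obtain rfl | hk0 := k.eq_zero_or_pos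
        · exact (hdep 0 (by omega) (fun j hj => absurd hj (Nat.not_lt_zero _))).mp hy
        · simpa using hak ⟨0, by omega⟩ hk0
      · simpa [completionCount] using hthin v
    | succ r ih =>
      intro hr
      obtain ⟨S, φ, hS, h⟩ := ih (by omega)
      obtain ⟨u, hu, x, hx⟩ := h.exists_extend hX hE hdep hm hm' hδ0 hK hδ hb (by
        rintro rfl
        rw [card_univ] at hS
        omega)
      exact ⟨_, _, by rw [card_insert_of_notMem hu, hS], hx⟩
  obtain ⟨S, φ, hS, h⟩ := key _ le_rfl
  obtain rfl := (card_eq_iff_eq_univ S).1 hS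
  exact ⟨φ, by simpa using h.injOn, fun a ha => h.mem a ha l le_rfl (by simp)⟩

end Embedding

theorem card_filter_comp_of_dependsOn {V W X : Type*} [Fintype V] [DecidableEq V] [Fintype W]
    [DecidableEq W] [Fintype X] [Nonempty X] {D : (V → X) → Prop} [DecidablePred D] {L : Finset V}
    (hD : DependsOn D L) {e : V → W} (he : Set.InjOn e L) :
    (#{ψ : V → X | D ψ} : ℝ) * (Fintype.card X : ℝ) ^ Fintype.card W =
      #{χ : W → X | D (χ ∘ e)} * (Fintype.card X : ℝ) ^ Fintype.card V := by
  classical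
  obtain ⟨x₀⟩ := ‹Nonempty X›
  let ext (χ : L → X) (v : V) : X := if h : v ∈ L then χ ⟨v, h⟩ else x₀
  let g (χ : L → X) : ℝ := if D (ext χ) then 1 else 0
  have h1 := sum_comp_injective (X := X) (Subtype.val_injective : Function.Injective
    (Subtype.val : L → V)) g
  have h2 := sum_comp_injective (X := X) (ι := fun v : L => e v)
    (fun v w h => Subtype.ext (he v.2 w.2 h)) g
  have e1 : ∀ ψ : V → X, g (ψ ∘ Subtype.val) = if D ψ then 1 else 0 := fun ψ => by
    have : D (ext (ψ ∘ Subtype.val)) = D ψ := hD fun v hv => by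
      simp [ext, mem_coe.1 hv]
    simp only [g, this]
  have e2 : ∀ χ : W → X, g (χ ∘ fun v : L => e v) = if D (χ ∘ e) then 1 else 0 := fun χ => by
    have : D (ext (χ ∘ fun v : L => e v)) = D (χ ∘ e) := hD fun v hv => by
      simp [ext, mem_coe.1 hv]
    simp only [g, this]
  simp only [e1, e2, sum_boole] at h1 h2
  have hX : (0 : ℝ) < (Fintype.card X : ℝ) ^ Fintype.card L := by
    have : 0 < Fintype.card X := Fintype.card_pos_iff.2 ⟨x₀⟩
    positivity
  refine mul_right_cancel₀ hX.ne' ?_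
  linear_combination (Fintype.card X : ℝ) ^ Fintype.card W * h1 -
    (Fintype.card X : ℝ) ^ Fintype.card V * h2

theorem exists_injOn_of_card_le {V : Type*} {m : ℕ} (hm : 0 < m) (L : Finset V) (hL : #L ≤ m) :
    ∃ e : V → Fin m, Set.InjOn e L := by
  classical
  obtain ⟨f⟩ := Function.Embedding.nonempty_of_card_le (α := L) (β := Fin m) (by simpa using hL)
  refine ⟨fun v => if h : v ∈ L then f ⟨v, h⟩ else ⟨0, hm⟩, fun v hv w hw h => ?_⟩
  simp only [mem_coe] at hv hw
  simpa [hv, hw] using h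

theorem thin_bound_lt_one {l m : ℕ} (hl : 2 ≤ l) (hm : 0 < m) {η : ℝ} (hη : 0 < η)
    (hη1 : η ≤ 1 / 2) :
    2 * 2 ^ (m ^ l) * ((η ^ ((4 * m) ^ (l - 1))) ^ 3 / η ^ ((4 * m) ^ (l - 1))) ^ (4 * m) *
      (4 * m / (η ^ ((4 * m) ^ (l - 1))) ^ 3) ^ m < 1 := by
  set θ : ℝ := η ^ ((4 * m) ^ (l - 1)) with hθ
  have hθ0 : 0 < θ := by positivity
  have hle : θ ≤ (1 / 2) ^ ((4 * m) ^ (l - 1)) := pow_le_pow_left₀ hη.le hη1 _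
  have h1 : θ * 2 ^ (m ^ (l - 1)) ≤ 1 := by
    have h : (1 / 2 : ℝ) ^ ((4 * m) ^ (l - 1)) ≤ (1 / 2) ^ (m ^ (l - 1)) :=
      pow_le_pow_of_le_one (by norm_num) (by norm_num) (Nat.pow_le_pow_left (by omega) _)
    calc θ * 2 ^ (m ^ (l - 1)) ≤ (1 / 2) ^ (m ^ (l - 1)) * 2 ^ (m ^ (l - 1)) := by
          gcongr; exact hle.trans h
      _ = 1 := by rw [← mul_pow]; norm_num
  have h2 : θ * (4 * m) ≤ 1 := by
    have h : (1 / 2 : ℝ) ^ ((4 * m) ^ (l - 1)) ≤ (1 / 2) ^ (4 * m) :=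
      pow_le_pow_of_le_one (by norm_num) (by norm_num) (Nat.le_self_pow (by omega) _)
    have h' : (4 * m : ℝ) ≤ 2 ^ (4 * m) := by exact_mod_cast Nat.lt_two_pow_self.le
    calc θ * (4 * m) ≤ (1 / 2) ^ (4 * m) * 2 ^ (4 * m) := by
          gcongr; exact hle.trans h
      _ = 1 := by rw [← mul_pow]; norm_num
  have hm1 : (1 : ℝ) ≤ m := by exact_mod_cast hm
  have h3 : θ ≤ 1 / 4 := by nlinarith
  have h4 : θ ^ m ≤ 1 / 4 := (pow_le_of_le_one hθ0.le (by linarith) hm.ne').trans h3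
  have hml : m ^ l = m ^ (l - 1) * m := by rw [← pow_succ]; congr 1; omega
  have heq : 2 * 2 ^ (m ^ l) * (θ ^ 3 / θ) ^ (4 * m) * (4 * m / θ ^ 3) ^ m =
      2 * θ ^ m * (θ * 2 ^ (m ^ (l - 1))) ^ m * (θ * (4 * m)) ^ m * (θ ^ m * θ ^ m) := by
    have e1 : θ ^ 3 / θ = θ ^ 2 := by field_simp
    rw [e1, hml, div_pow, ← pow_mul, ← pow_mul, mul_pow θ, mul_pow θ, ← pow_mul]
    field_simp
    ring
  rw [heq]
  have h5 := pow_le_one₀ (n := m) (by positivity) h1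
  have h6 := pow_le_one₀ (n := m) (by positivity) h2
  calc _ ≤ 2 * (1 / 4 : ℝ) * 1 * 1 * (1 / 4 * (1 / 4)) := by gcongr
    _ < 1 := by norm_num

theorem exists_embedding_of_dense {l Δ : ℕ} (hl : 2 ≤ l) (hΔ : 0 < Δ) {V X : Type*} [Fintype V]
    [DecidableEq V] [Fintype X] [DecidableEq X] {p : V → Fin l} {E : Finset (Fin l → V)}
    (hE : ∀ a ∈ E, ∀ j, p (a j) = j) (hdeg : ∀ v, #(edgesAt p E v) ≤ Δ)
    (G : Finset (Fin l → X)) {η : ℝ} (hη : 0 < η) (hη1 : η ≤ 1 / 2)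
    (hG : 2 * η * (Fintype.card X : ℝ) ^ l ≤ #G) (hX : 0 < Fintype.card X)
    (hN : 2 * (Fintype.card V : ℝ) ≤
      (η ^ ((4 * (l * Δ)) ^ (l - 1))) ^ 3 * Fintype.card X) :
    ∃ φ : V → X, Function.Injective φ ∧ ∀ a ∈ E, φ ∘ a ∈ G := by
  set m := l * Δ with hmdef
  have hm : 0 < m := by positivity
  set θ : ℝ := η ^ ((4 * m) ^ (l - 1)) with hθ
  have hθ0 : 0 < θ := by positivity
  have hX' : (0 : ℝ) < Fintype.card X := by exact_mod_cast hX
  have : Nonempty X := Fintype.card_pos_iff.1 hX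
  have hm1 : (1 : ℝ) ≤ m := by exact_mod_cast hm
  obtain ⟨H, hHl, hH, hthin⟩ := exists_chain (l := l) (s := 4 * m) (m := m) (β := θ ^ 3)
    (by omega) hX hη (by linarith) (by positivity) le_rfl l le_rfl G
    (fun x y hxy => by rw [funext fun j => hxy j j.2]) (by simpa using hG)
  have hθ1 : θ ^ 3 ≤ 1 := pow_le_one₀ hθ0.le (pow_le_one₀ hη.le (by linarith))
  have hL := fun v => card_earlierNeighbors_le (hdeg v)
  obtain ⟨φ, hφ, hφE⟩ := exists_embedding (b := θ ^ 3 * Fintype.card X)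
    (δ := 2 * 2 ^ (m ^ l) * (θ ^ 3 / θ) ^ (4 * m)) (K := 4 * m / θ ^ 3) (m := m) (p := p)
    (E := E) (H := H) hX hE (fun k hk => (hH k hk).1)
    (by
      rw [← card_pos, ← Nat.cast_pos (α := ℝ)]
      exact lt_of_lt_of_le (by positivity) (hH 0 (Nat.zero_le _)).2)
    hL (card_mem_earlierNeighbors_le hE hdeg) (by positivity)
    (by rw [le_div_iff₀ (by positivity)]; linarith)
    (thin_bound_lt_one hl hm hη hη1)
    (by
      have : (m : ℝ) * (Fintype.card X / (4 * m / θ ^ 3)) = θ ^ 3 * Fintype.card X / 4 := by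
        field_simp
      rw [this]
      have : 0 < θ ^ 3 * Fintype.card X := by positivity
      linarith)
    (fun v => by
      obtain ⟨e, he⟩ := exists_injOn_of_card_le hm _ (hL v)
      have h1 := card_filter_comp_of_dependsOn
        (dependsOn_thinAt (p := p) (E := E) (θ ^ 3 * Fintype.card X)
          (fun k hk => (hH k hk).1) v) he
      have h2 := hthin (p v) (p v).2 ((edgesAt p E v).image (e ∘ ·))
      simp only [image_image] at h2
      rw [Fintype.card_fin] at h1
      refine le_of_mul_le_mul_right ?_ (by positivity : 0 < (Fintype.card X : ℝ) ^ m)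
      rw [h1, mul_right_comm]
      exact mul_le_mul_of_nonneg_right h2 (by positivity))
  exact ⟨φ, hφ, fun a ha => hHl ▸ hφE a ha⟩

theorem exists_eq_image_of_card_filter_eq_one {l : ℕ} {V : Type*} [DecidableEq V] {p : V → Fin l}
    {e : Finset V} (he : ∀ j : Fin l, #{v ∈ e | p v = j} = 1) :
    ∃ a : Fin l → V, e = univ.image a ∧ ∀ j, p (a j) = j := by
  choose a ha using fun j => card_eq_one.1 (he j)
  have hmem : ∀ j v, (v ∈ e ∧ p v = j) ↔ v = a j := fun j v => by
    rw [← mem_filter (s := e) (p := fun v => p v = j), ha j, mem_singleton]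
  refine ⟨a, ?_, fun j => ((hmem j _).2 rfl).2⟩
  ext v
  simp only [mem_image, mem_univ, true_and]
  constructor
  · exact fun hv => ⟨p v, ((hmem _ v).1 ⟨hv, rfl⟩).symm⟩
  · rintro ⟨j, rfl⟩
    exact ((hmem j _).2 rfl).1

/-- For every l ≥ 3 there is a constant c = c(l) such that: if F is an l-uniform
l-partite hypergraph (parts given by the map pF) with n vertices and maximum degree Δ ≥ 1, and
G is an l-uniform l-partite hypergraph with parts V_1,...,V_l of size N (vertex type
Fin l × Fin N, the part of a vertex being its first coordinate) with at least ε·N^l edges,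
0 < ε ≤ 1, and N ≥ (ε/2)^{-c·Δ^{l-1}}·n, then G contains a copy of F. -/
theorem stmt_1 :
    ∀ l : ℕ, 3 ≤ l →
    ∃ c : ℕ, 0 < c ∧
      ∀ (n Δ : ℕ), 1 ≤ Δ →
      ∀ (F : Finset (Finset (Fin n))) (pF : Fin n → Fin l),
        (∀ e ∈ F, ∀ j : Fin l, (e.filter fun v => pF v = j).card = 1) →
        (∀ v : Fin n, (F.filter fun e => v ∈ e).card ≤ Δ) →
      ∀ (N : ℕ) (G : Finset (Finset (Fin l × Fin N))) (ε : ℝ),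
        0 < ε → ε ≤ 1 →
        (∀ e ∈ G, ∀ j : Fin l, (e.filter fun x => x.1 = j).card = 1) →
        ε * (N : ℝ) ^ l ≤ (G.card : ℝ) →
        (ε / 2) ^ (-((c * Δ ^ (l - 1) : ℕ) : ℤ)) * (n : ℝ) ≤ (N : ℝ) →
        ∃ f : Fin n → Fin l × Fin N, Function.Injective f ∧
          ∀ e ∈ F, e.image f ∈ G := by
  intro l hl
  refine ⟨3 * (4 * l) ^ (l - 1) + 1, by positivity, ?_⟩
  intro n Δ hΔ F pF hF hdeg N G ε hε hε1 hG hcard hN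
  obtain rfl | hn := n.eq_zero_or_pos
  · refine ⟨Fin.elim0, fun v => v.elim0, fun e he => ?_⟩
    have := hF e he ⟨0, by omega⟩
    simp [Subsingleton.elim e ∅] at this
  have hη : 0 < ε / 2 := by positivity
  have hη1 : ε / 2 ≤ 1 / 2 := by linarith
  set η := ε / 2 with hηdef
  have hNn : (n : ℝ) ≤ η ^ ((3 * (4 * l) ^ (l - 1) + 1) * Δ ^ (l - 1)) * N := by
    rwa [zpow_neg, zpow_natCast, inv_mul_le_iff₀ (by positivity)] at hN
  have hN0 : 0 < N := by
    rw [Nat.pos_iff_ne_zero]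
    rintro rfl
    simp at hNn
    omega
  let E : Finset (Fin l → Fin n) := {a | univ.image a ∈ F ∧ ∀ j, pF (a j) = j}
  let G' : Finset (Fin l → Fin N) := {x | (univ.image fun j => (j, x j)) ∈ G}
  have hcardG : #G ≤ #G' := by
    refine (card_le_card fun e he => ?_).trans
      (card_image_le (f := fun x : Fin l → Fin N => univ.image fun j => (j, x j)))
    obtain ⟨a, rfl, ha⟩ := exists_eq_image_of_card_filter_eq_one (hG e he)
    have haj : (fun j => (j, (a j).2)) = a := funext fun j => Prod.ext (ha j).symm rfl
    refine mem_image.2 ⟨fun j => (a j).2, mem_filter.2 ⟨mem_univ _, ?_⟩, ?_⟩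
    · rwa [haj]
    · rw [haj]
  have hE : ∀ a ∈ E, ∀ j, pF (a j) = j := fun a ha => (mem_filter.1 ha).2.2
  have hdegE : ∀ v, #(edgesAt pF E v) ≤ Δ := by
    refine fun v => le_trans (card_le_card_of_injOn (fun a => univ.image a) ?_ ?_) (hdeg v)
    · intro a ha
      obtain ⟨haE, hav⟩ := mem_filter.1 ha
      exact mem_filter.2 ⟨(mem_filter.1 haE).2.1, mem_image.2 ⟨pF v, mem_univ _, hav⟩⟩
    · intro a ha a' ha' h
      have ha := hE a (mem_filter.1 ha).1
      have ha' := hE a' (mem_filter.1 ha').1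
      ext1 j
      have hj : a j ∈ univ.image a' := (show univ.image a = univ.image a' from h) ▸
        mem_image_of_mem a (mem_univ j)
      obtain ⟨k, -, hk⟩ := mem_image.1 hj
      have : k = j := by rw [← ha' k, hk, ha j]
      rw [← hk, this]
  obtain ⟨φ, hφ, hφE⟩ := exists_embedding_of_dense (by omega) hΔ hE hdegE G' hη hη1
    (by
      rw [Fintype.card_fin, hηdef, mul_div_cancel₀ _ two_ne_zero]
      exact hcard.trans (by exact_mod_cast hcardG))
    (by simpa using hN0)
    (by
      simp only [Fintype.card_fin]
      have he : 3 * (4 * (l * Δ)) ^ (l - 1) + 1 ≤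
          (3 * (4 * l) ^ (l - 1) + 1) * Δ ^ (l - 1) := by
        have : 1 ≤ Δ ^ (l - 1) := Nat.one_le_pow _ _ hΔ
        rw [← mul_assoc, mul_pow, add_mul]
        linarith
      set B := (η ^ (4 * (l * Δ)) ^ (l - 1)) ^ 3 with hBdef
      have h1 : _ ≤ B * η := (pow_le_pow_of_le_one hη.le (by linarith) he).trans_eq (by
        rw [pow_succ, mul_comm 3, pow_mul])
      have hB : 0 ≤ B := by positivity
      have h2 : η ^ ((3 * (4 * l) ^ (l - 1) + 1) * Δ ^ (l - 1)) ≤ B * (1 / 2) :=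
        h1.trans (by gcongr)
      have h3 := hNn.trans (mul_le_mul_of_nonneg_right h2 (Nat.cast_nonneg N))
      linarith)
  refine ⟨fun v => (pF v, φ v), fun v w h => hφ (congrArg Prod.snd h), fun e he => ?_⟩
  obtain ⟨a, rfl, ha⟩ := exists_eq_image_of_card_filter_eq_one (hF e he)
  have := (mem_filter.1 (hφE a (mem_filter.2 ⟨mem_univ _, he, ha⟩))).2
  rw [image_image]
  convert this using 2
  ext1 j
  simp [ha j]
end

section
/- Let l ≥ 3 and let F be an l-uniform l-partite hypergraph on parts W_1,...,W_l with at most n vertices and maximum degree Δ ≥ 1. Let G_l be an l-uniform l-partite hypergraph on parts V_1,...,V_l with |V_1| = ... = |V_l| = N and at least ε·N^l edges, where 0 < ε ≤ 1. If N ≥ (ε/2)^{-(2lΔ)^{l-1}}·n, then G_l contains a copy of F. -/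
open Finset
open scoped BigOperators

/-- The proportion of elements of a finite type satisfying a predicate. -/
noncomputable def prob {Ω : Type*} [Fintype Ω] (p : Ω → Prop) : ℝ :=
  open Classical in 𝔼 ω, if p ω then (1 : ℝ) else 0

section prob

variable {Ω Ω' : Type*} [Fintype Ω] [Fintype Ω']

lemma prob_nonneg (p : Ω → Prop) : 0 ≤ prob p :=
  expect_nonneg fun _ _ => by split_ifs <;> norm_num

lemma prob_mono {p q : Ω → Prop} (h : ∀ ω, p ω → q ω) : prob p ≤ prob q := by
  classical
  refine expect_le_expect fun ω _ => ?_
  by_cases hp : p ω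
  · simp [hp, h ω hp]
  · simp only [hp, if_false]
    split_ifs <;> norm_num

lemma prob_const [Nonempty Ω] (a : Prop) [Decidable a] :
    prob (fun _ : Ω => a) = if a then 1 else 0 := by
  classical
  unfold prob
  rw [Fintype.expect_const]
  congr

lemma prob_le_one [Nonempty Ω] (p : Ω → Prop) : prob p ≤ 1 := by
  classical
  calc prob p ≤ prob (fun _ : Ω => True) := prob_mono fun _ _ => trivial
    _ = 1 := by simp [prob_const]

lemma expect_prob_comm (p : Ω → Ω' → Prop) :
    𝔼 a, prob (fun b => p a b) = 𝔼 b, prob (fun a => p a b) :=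
  expect_comm _ _ _

lemma prob_equiv (e : Ω ≃ Ω') (p : Ω' → Prop) : prob (fun a => p (e a)) = prob p :=
  Fintype.expect_equiv e _ _ fun _ => rfl

lemma card_filter_eq_prob_mul [Nonempty Ω] (p : Ω → Prop) [DecidablePred p] :
    ((univ.filter p).card : ℝ) = prob p * Fintype.card Ω := by
  classical
  have h : (Fintype.card Ω : ℝ) ≠ 0 := by exact_mod_cast Fintype.card_ne_zero
  rw [prob, Fintype.expect_eq_sum_div_card, div_mul_cancel₀ _ h]
  rw [card_filter, Nat.cast_sum]
  exact sum_congr rfl fun ω _ => by split_ifs <;> simp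

lemma prob_forall (p : Ω → Prop) (s : ℕ) :
    prob (fun x : Fin s → Ω => ∀ i, p (x i)) = prob p ^ s := by
  classical
  simp only [prob, Fintype.expect_eq_sum_div_card, div_pow, Fintype.sum_pow]
  congr 1
  · refine sum_congr rfl fun x _ => ?_
    simp [prod_ite_zero]
  · simp

/-- Resampling one coordinate of a uniformly random function does not change its distribution. -/
lemma expect_prob_update {ι X : Type*} [Fintype ι] [DecidableEq ι] [Fintype X] [Nonempty X]
    (j : ι) (p : (ι → X) → Prop) :
    𝔼 y, prob (fun v : ι → X => p (Function.update v j y)) = prob p := by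
  classical
  let f : X × (ι → X) → X × (ι → X) := fun a => (a.2 j, Function.update a.2 j a.1)
  have hf : Function.Involutive f := fun a => by simp [f]
  have h := Fintype.expect_equiv hf.toPerm
    (fun a : X × (ι → X) => if p (Function.update a.2 j a.1) then (1 : ℝ) else 0)
    (fun a => if p a.2 then (1 : ℝ) else 0) (fun _ => rfl)
  rw [← univ_product_univ, expect_product, expect_product] at h
  exact h.trans (Fintype.expect_const (ι := X) (prob p))

lemma prob_comp_injective {A B X : Type*} [Fintype A] [Fintype B] [Fintype X] [Nonempty X]
    {f : A → B} (hf : Function.Injective f) (p : (A → X) → Prop) [DecidableEq A] [DecidableEq B] :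
    prob (fun h : B → X => p (h ∘ f)) = prob p := by
  classical
  let e : A ⊕ ((Set.range f)ᶜ : Set B) ≃ B :=
    ((Equiv.ofInjective f hf).sumCongr (Equiv.refl _)).trans (Equiv.Set.sumCompl _)
  have he : ∀ a, e (Sum.inl a) = f a := fun a => by simp [e]
  let E : (B → X) ≃ (A → X) × (((Set.range f)ᶜ : Set B) → X) :=
    (Equiv.arrowCongr e.symm (Equiv.refl X)).trans (Equiv.sumArrowEquivProdArrow _ _ _)
  have hE : ∀ h, (E h).1 = h ∘ f := fun h => by
    ext a; simp [E, Equiv.sumArrowEquivProdArrow, he]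
  have h1 : prob (fun h : B → X => p (h ∘ f)) =
      prob (fun q : (A → X) × (((Set.range f)ᶜ : Set B) → X) => p q.1) := by
    rw [← prob_equiv E]; simp only [hE]
  rw [h1, prob, ← univ_product_univ, expect_product]
  exact expect_congr rfl fun a _ => Fintype.expect_const (ι := ((Set.range f)ᶜ : Set B) → X) (if p a then (1 : ℝ) else 0)

end prob

/-- The family `t` is dangerous if it lies in `E'` but extends to `E` in coordinate `j` in
few ways. -/
def Dangerous {ι X D : Type*} [DecidableEq ι] [Fintype X] (E E' : Set (ι → X)) (j : ι) (γ : ℝ)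
    (t : D → ι → X) : Prop :=
  (∀ i, t i ∈ E') ∧ prob (fun y => ∀ i, Function.update (t i) j y ∈ E) < γ

/-- The tuples all of whose modifications in coordinate `j` by the entries of `x` lie in `E`. -/
def commonLink {ι X D : Type*} [DecidableEq ι] (E : Set (ι → X)) (j : ι) (x : D → X) :
    Set (ι → X) :=
  {v | ∀ i, Function.update v j (x i) ∈ E}

section DependentRandomChoice

variable {ι X : Type*} [DecidableEq ι] [Fintype X] [Nonempty X]

lemma pow_prob_le_expect_commonLink [Fintype ι] (E : Set (ι → X)) (j : ι) (s : ℕ) :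
    prob (· ∈ E) ^ s ≤ 𝔼 x : Fin s → X, prob (· ∈ commonLink E j x) := by
  classical
  have h1 : 𝔼 x : Fin s → X, prob (· ∈ commonLink E j x) =
      𝔼 v : ι → X, prob (fun y => Function.update v j y ∈ E) ^ s := by
    simp only [← prob_forall]
    exact expect_prob_comm _
  have h2 : prob (· ∈ E) = 𝔼 v : ι → X, prob (fun y => Function.update v j y ∈ E) := by
    rw [← expect_prob_comm (fun y v => Function.update v j y ∈ E), expect_prob_update j (· ∈ E)]
  have hN : (Fintype.card (ι → X) : ℝ) ≠ 0 := by exact_mod_cast Fintype.card_ne_zero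
  have h3 := Real.pow_arith_mean_le_arith_mean_pow (univ : Finset (ι → X))
    (fun _ => (1 : ℝ) / Fintype.card (ι → X))
    (fun v => prob (fun y => Function.update v j y ∈ E)) (fun _ _ => by positivity)
    (by rw [sum_const, nsmul_eq_mul, card_univ]; field_simp) (fun _ _ => prob_nonneg _) s
  rw [h1, h2]
  simpa only [← mul_sum, Fintype.expect_eq_sum_div_card, div_eq_inv_mul, mul_one] using h3

lemma expect_prob_dangerous_le {H D : Type*} [Fintype H] [Nonempty H] (E : Set (ι → X)) (j : ι)
    (s : ℕ) {γ : ℝ} (hγ : 0 ≤ γ) (t : H → D → ι → X) :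
    𝔼 x : Fin s → X, prob (fun h => Dangerous E (commonLink E j x) j γ (t h)) ≤ γ ^ s := by
  rw [expect_prob_comm]
  refine expect_le univ_nonempty fun h _ => ?_
  by_cases hq : prob (fun y => ∀ i, Function.update (t h i) j y ∈ E) < γ
  · calc _ ≤ prob (fun x : Fin s → X => ∀ k, ∀ i, Function.update (t h i) j (x k) ∈ E) :=
          prob_mono fun x hx k i => hx.1 i k
      _ = prob (fun y => ∀ i, Function.update (t h i) j y ∈ E) ^ s :=
          prob_forall (fun y => ∀ i, Function.update (t h i) j y ∈ E) s
      _ ≤ γ ^ s := pow_le_pow_left₀ (prob_nonneg _) hq.le s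
  · classical
    simp only [Dangerous, hq, and_false]
    rw [prob_const, if_neg not_false]
    positivity

/-- Dependent random choice in coordinate `j`. -/
lemma exists_commonLink [Fintype ι] {D Y : Type*} [Fintype D] [Fintype Y] [DecidableEq D] [DecidableEq Y]
    (E : Set (ι → X)) (j : ι) (s : ℕ) {ε γ : ℝ} (hε : 0 ≤ ε) (hγ : 0 < γ)
    (hγε : γ ≤ ε ^ (s + 1) / 2) (hE : ε ≤ prob (· ∈ E)) [Nonempty Y] :
    ∃ x : Fin (s + 1) → X, ε ^ (s + 1) / 2 ≤ prob (· ∈ commonLink E j x) ∧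
      ∀ c : D → ι → Y, prob (fun h : Y → X =>
        Dangerous E (commonLink E j x) j γ (fun i => h ∘ c i)) ≤
          (Fintype.card (D → ι → Y) : ℝ) * γ ^ s := by
  classical
  let P : ℝ := (Fintype.card (D → ι → Y) : ℕ)
  have hP : 0 < P := by simp only [P]; exact_mod_cast Fintype.card_pos
  let d : (Fin (s + 1) → X) → (D → ι → Y) → ℝ := fun x c => prob (fun h : Y → X =>
        Dangerous E (commonLink E j x) j γ (fun i => h ∘ c i))
  have h1 : 𝔼 x, ∑ c, d x c ≤ P * γ ^ (s + 1) := by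
    rw [expect_sum_comm]
    calc _ ≤ ∑ _c : D → ι → Y, γ ^ (s + 1) :=
          sum_le_sum fun c _ => expect_prob_dangerous_le E j (s + 1) hγ.le
            (fun (h : Y → X) i => h ∘ c i)
      _ = P * γ ^ (s + 1) := by simp [P]
  have h2 : ε ^ (s + 1) ≤ 𝔼 x : Fin (s + 1) → X, prob (· ∈ commonLink E j x) :=
    (pow_le_pow_left₀ hε hE _).trans (pow_prob_le_expect_commonLink E j _)
  have h3 : P * γ ^ s * (ε ^ (s + 1) / 2) ≤
      𝔼 x, (P * γ ^ s * prob (· ∈ commonLink E j x) - ∑ c, d x c) := by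
    rw [expect_sub_distrib, ← mul_expect]
    have : P * γ ^ s * ε ^ (s + 1) ≤
      P * γ ^ s * 𝔼 x : Fin (s + 1) → X, prob (· ∈ commonLink E j x) := by gcongr
    have : P * γ ^ s * γ ≤ P * γ ^ s * (ε ^ (s + 1) / 2) := by gcongr
    rw [pow_succ γ] at h1
    linarith
  obtain ⟨x, -, hx⟩ := exists_le_of_le_expect univ_nonempty h3
  have hd : ∀ c, 0 ≤ d x c := fun c => prob_nonneg _
  have hPs : 0 < P * γ ^ s := by positivity
  refine ⟨x, ?_, fun c => ?_⟩
  · have := sum_nonneg fun c (_ : c ∈ univ) => hd c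
    exact le_of_mul_le_mul_left (by linarith) hPs
  · have h4 : d x c ≤ ∑ c, d x c := single_le_sum (fun c _ => hd c) (mem_univ c)
    have h5 : P * γ ^ s * prob (· ∈ commonLink E j x) ≤ P * γ ^ s * 1 :=
      mul_le_mul_of_nonneg_left (prob_le_one _) hPs.le
    have h6 : 0 ≤ P * γ ^ s * (ε ^ (s + 1) / 2) := by positivity
    change d x c ≤ P * γ ^ s
    linarith

end DependentRandomChoice

/-- A set of tuples determined by the coordinates from `j` on. -/
def IgnoresBelow {l : ℕ} {X : Type*} (j : ℕ) (E : Set (Fin l → X)) : Prop :=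
  ∀ v v' : Fin l → X, (∀ k, j ≤ k.val → v k = v' k) → (v ∈ E ↔ v' ∈ E)

lemma IgnoresBelow.commonLink {l : ℕ} {X D : Type*} {E : Set (Fin l → X)} {j : Fin l}
    (h : IgnoresBelow j E) (x : D → X) : IgnoresBelow (j + 1) (commonLink E j x) := by
  intro v v' hv
  refine forall_congr' fun i => h _ _ fun k hk => ?_
  by_cases hkj : k = j
  · subst hkj; simp
  · rw [Function.update_of_ne hkj, Function.update_of_ne hkj]
    exact hv k (lt_of_le_of_ne hk fun h' => hkj (Fin.ext h'.symm))

/-- The densities guaranteed by iterating dependent random choice with `s` samples. -/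
noncomputable def levelDensity (ε : ℝ) (s : ℕ) : ℕ → ℝ
  | 0 => ε
  | j + 1 => levelDensity ε s j ^ s / 2

section levelDensity

variable {ε : ℝ} {s : ℕ}

lemma levelDensity_pos (hε : 0 < ε) (j : ℕ) : 0 < levelDensity ε s j := by
  induction j with
  | zero => exact hε
  | succ j ih => exact half_pos (pow_pos ih s)

lemma levelDensity_le_one (hε : 0 < ε) (h1 : ε ≤ 1) (j : ℕ) : levelDensity ε s j ≤ 1 := by
  induction j with
  | zero => exact h1
  | succ j ih =>
    have := pow_le_one₀ (levelDensity_pos (s := s) hε j).le ih (n := s)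
    simp only [levelDensity]
    linarith

lemma levelDensity_antitone (hε : 0 < ε) (h1 : ε ≤ 1) (hs : s ≠ 0) :
    Antitone (levelDensity ε s) := by
  refine antitone_nat_of_succ_le fun j => ?_
  have h0 := levelDensity_pos (s := s) hε j
  have := pow_le_of_le_one h0.le (levelDensity_le_one hε h1 j) hs
  simp only [levelDensity]
  linarith

lemma two_mul_pow_le_levelDensity (hε : 0 < ε) (hs : 2 ≤ s) (j : ℕ) :
    2 * (ε / 2) ^ s ^ j ≤ levelDensity ε s j := by
  induction j with
  | zero => simp only [levelDensity, pow_zero, pow_one]; linarith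
  | succ j ih =>
    have h1 : (2 * (ε / 2) ^ s ^ j) ^ s ≤ levelDensity ε s j ^ s :=
      pow_le_pow_left₀ (by positivity) ih s
    rw [mul_pow, ← pow_mul, ← pow_succ] at h1
    have h2 : (2 : ℝ) ^ 2 ≤ 2 ^ s := pow_le_pow_right₀ (by norm_num) hs
    have h3 : 0 < (ε / 2) ^ s ^ (j + 1) := by positivity
    simp only [levelDensity]
    nlinarith

lemma levelDensity_le_inv_pow (hε : 0 < ε) (h1 : ε ≤ 1) (hs : s ≠ 0) {j : ℕ} (hj : 2 ≤ j) :
    levelDensity ε s j ≤ (1 / 2) ^ (s + 1) := by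
  refine (levelDensity_antitone hε h1 hs hj).trans ?_
  have h2 : levelDensity ε s 1 ≤ 1 / 2 := by
    have := pow_le_one₀ hε.le h1 (n := s)
    simp only [levelDensity]
    linarith
  have := pow_le_pow_left₀ (levelDensity_pos hε 1).le h2 s
  change levelDensity ε s 1 ^ s / 2 ≤ _
  rw [pow_succ]
  linarith

end levelDensity

lemma two_mul_sq_le_three_mul_two_pow {m : ℕ} (hm : 3 ≤ m) : 8 * (2 * m ^ 2) ≤ 3 * 2 ^ (2 * m) := by
  induction m, hm using Nat.le_induction with
  | base => norm_num
  | succ m hm ih =>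
    rw [show 2 * (m + 1) = 2 * m + 2 by ring, pow_add]
    nlinarith

lemma pow_mul_pow_lt_pow {m : ℕ} (hm : 3 ≤ m) {γ : ℝ} (h0 : 0 < γ)
    (hγ : γ ≤ (1 / 2) ^ (2 * m + 1)) :
    (m : ℝ) ^ m * γ ^ (2 * m - 1) < (γ / (2 * m)) ^ m := by
  have hm0 : (0 : ℝ) < m := by exact_mod_cast (by omega : 0 < m)
  have h1 : (2 * (m : ℝ) ^ 2) ≤ 3 / 4 * 2 ^ (2 * m - 1) := by
    have h := two_mul_sq_le_three_mul_two_pow hm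
    rw [show 2 * m = (2 * m - 1) + 1 by omega, pow_succ] at h
    have : (8 : ℝ) * (2 * m ^ 2) ≤ 3 * (2 ^ (2 * m - 1) * 2) := by exact_mod_cast h
    linarith
  have h2 : ((3 : ℝ) / 4) ^ m < 1 / 2 :=
    (pow_le_pow_of_le_one (by norm_num) (by norm_num) hm).trans_lt (by norm_num)
  have h3 : (2 * (m : ℝ) ^ 2) ^ m * γ ^ (m - 1) < 1 := by
    calc (2 * (m : ℝ) ^ 2) ^ m * γ ^ (m - 1)
        ≤ (3 / 4 * 2 ^ (2 * m - 1)) ^ m * ((1 / 2) ^ (2 * m + 1)) ^ (m - 1) := by gcongr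
      _ = (3 / 4) ^ m * (2 * (2 ^ ((2 * m + 1) * (m - 1)) * (1 / 2) ^ ((2 * m + 1) * (m - 1)))) := by
          rw [mul_pow, ← pow_mul, ← pow_mul, ← mul_assoc, mul_assoc, mul_assoc, ← mul_assoc 2,
            ← pow_succ']
          congr 4
          obtain ⟨k, rfl⟩ : ∃ k, m = k + 1 := ⟨m - 1, by omega⟩
          rw [show 2 * (k + 1) - 1 = 2 * k + 1 by omega, show k + 1 - 1 = k by omega]
          ring
      _ = (3 / 4) ^ m * 2 := by rw [← mul_pow]; norm_num
      _ < 1 := by linarith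
  rw [div_pow, lt_div_iff₀ (by positivity)]
  calc (m : ℝ) ^ m * γ ^ (2 * m - 1) * (2 * m) ^ m
      = ((2 * (m : ℝ) ^ 2) ^ m * γ ^ (m - 1)) * γ ^ m := by
        rw [show 2 * m - 1 = (m - 1) + m by omega, pow_add]
        rw [show (2 * (m : ℝ) ^ 2) = m * (2 * m) by ring, mul_pow (m : ℝ)]
        ring
    _ < 1 * γ ^ m := by gcongr
    _ = γ ^ m := one_mul _

lemma exists_chain_s2 {L s : ℕ} {X D Y : Type*} [Fintype X] [Nonempty X] [Fintype D] [Fintype Y]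
    [DecidableEq D] [DecidableEq Y] [Nonempty Y] {ε γ : ℝ} (hε : 0 < ε) (hε1 : ε ≤ 1) (hγ : 0 < γ)
    (hγL : γ ≤ levelDensity ε (s + 1) L) (E₀ : Set (Fin (L + 1) → X)) (hE₀ : ε ≤ prob (· ∈ E₀)) :
    ∃ E : ℕ → Set (Fin (L + 1) → X), E 0 = E₀ ∧ (∀ j, IgnoresBelow j (E j)) ∧
      E (L + 1) = Set.univ ∧
      ∀ (j : Fin (L + 1)) (c : D → Fin (L + 1) → Y), prob (fun h : Y → X =>
        Dangerous (E j) (E (j + 1)) j γ (fun i => h ∘ c i)) ≤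
          (Fintype.card (D → Fin (L + 1) → Y) : ℝ) * γ ^ s := by
  have step : ∀ (j : ℕ) (E : Set (Fin (L + 1) → X)), ∃ E' : Set (Fin (L + 1) → X),
      ∀ hj : j < L, IgnoresBelow j E → levelDensity ε (s + 1) j ≤ prob (· ∈ E) →
        IgnoresBelow (j + 1) E' ∧ levelDensity ε (s + 1) (j + 1) ≤ prob (· ∈ E') ∧
        ∀ c : D → Fin (L + 1) → Y, prob (fun h : Y → X =>
          Dangerous E E' ⟨j, by omega⟩ γ (fun i => h ∘ c i)) ≤
            (Fintype.card (D → Fin (L + 1) → Y) : ℝ) * γ ^ s := by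
    intro j E
    by_cases h : j < L ∧ levelDensity ε (s + 1) j ≤ prob (· ∈ E)
    · obtain ⟨x, hx, hc⟩ := exists_commonLink (D := D) (Y := Y) E ⟨j, by omega⟩ s
        (levelDensity_pos hε j).le hγ
        (hγL.trans (levelDensity_antitone hε hε1 s.succ_ne_zero (Nat.succ_le_of_lt h.1))) h.2
      exact ⟨_, fun hj hE _ => ⟨hE.commonLink (j := ⟨j, by omega⟩) x, hx, hc⟩⟩
    · exact ⟨E, fun hj _ hd => absurd ⟨hj, hd⟩ h⟩
  choose next hnext using step
  let A : ℕ → Set (Fin (L + 1) → X) := fun j => Nat.rec E₀ next j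
  have hA : ∀ j ≤ L, IgnoresBelow j (A j) ∧ levelDensity ε (s + 1) j ≤ prob (· ∈ A j) := by
    intro j
    induction j with
    | zero => exact fun _ => ⟨fun v v' h => by rw [funext fun k => h k (Nat.zero_le _)], hE₀⟩
    | succ j ih =>
      intro hj
      obtain ⟨h1, h2⟩ := ih (by omega)
      obtain ⟨h3, h4, -⟩ := hnext j (A j) (by omega) h1 h2
      exact ⟨h3, h4⟩
  refine ⟨fun j => if j ≤ L then A j else Set.univ, by simp [A], fun j => ?_, by simp,
    fun j c => ?_⟩
  · by_cases hj : j ≤ L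
    · simpa only [hj, if_true] using (hA j hj).1
    · simp [hj, IgnoresBelow]
  have hjL : j.val ≤ L := Nat.le_of_lt_succ j.isLt
  by_cases hj : j.val < L
  · simp only [hjL, Nat.succ_le_of_lt hj, if_true]
    exact (hnext j (A j) hj (hA j hjL).1 (hA j hjL).2).2.2 c
  · have hjeq : j.val = L := by omega
    obtain ⟨h1, h2⟩ := hA j hjL
    have key : ∀ (v v' : Fin (L + 1) → X) y, Function.update v j y ∈ A j ↔
        Function.update v' j y ∈ A j := fun v v' y => h1 _ _ fun k hk => by
      obtain rfl : k = j := Fin.ext (by omega)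
      simp
    have h3 : ∀ t : D → Fin (L + 1) → X,
        γ ≤ prob (fun y => ∀ i, Function.update (t i) j y ∈ A j) := by
      intro t
      let v₀ : Fin (L + 1) → X := fun _ => Classical.arbitrary X
      calc γ ≤ prob (· ∈ A j) := by rw [hjeq] at h2 ⊢; exact hγL.trans h2
        _ = 𝔼 y, prob (fun v => Function.update v j y ∈ A j) :=
            (expect_prob_update j (· ∈ A j)).symm
        _ = prob (fun y => Function.update v₀ j y ∈ A j) := by
            classical
            refine expect_congr rfl fun y _ => ?_
            simp only [key _ v₀ y]
            rw [prob_const]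
        _ ≤ _ := prob_mono fun y hy i => (key _ v₀ y).2 hy
    classical
    simp only [hjL, if_true, Dangerous, not_lt.2 (h3 _), and_false]
    rw [prob_const, if_neg not_false]
    positivity

lemma card_filter_le_mul_le {X : Type*} [Fintype X] [Nonempty X] {f : X → ℝ} (hf : ∀ y, 0 ≤ f y)
    (b : ℝ) [DecidablePred fun y => b ≤ f y] :
    ((univ.filter fun y => b ≤ f y).card : ℝ) * b ≤ (𝔼 y, f y) * Fintype.card X := by
  have h : (Fintype.card X : ℝ) ≠ 0 := by exact_mod_cast Fintype.card_ne_zero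
  rw [Fintype.expect_eq_sum_div_card, div_mul_cancel₀ _ h, ← nsmul_eq_mul]
  exact (card_nsmul_le_sum _ _ _ fun y hy => (mem_filter.1 hy).2).trans
    (sum_le_sum_of_subset_of_nonneg (subset_univ _) fun y _ _ => hf y)

/-- Danger probabilities for a finite label set bound those for any vertex set. -/
lemma prob_comp_le_of_card_le {V ι D X Y : Type*} [Fintype V] [DecidableEq V] [Fintype X]
    [Nonempty X] [Fintype Y] [DecidableEq Y] [Fintype D] [Fintype ι] (T : D → ι → V)
    (hY : Fintype.card D * Fintype.card ι ≤ Fintype.card Y) (p : (D → ι → X) → Prop) {δ : ℝ}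
    (h : ∀ c : D → ι → Y, prob (fun x : Y → X => p fun i => x ∘ c i) ≤ δ) :
    prob (fun x : V → X => p fun i => x ∘ T i) ≤ δ := by
  classical
  let R : Finset V := univ.image fun q : D × ι => T q.1 q.2
  have hR : Fintype.card R ≤ Fintype.card Y := by
    rw [Fintype.card_coe]
    exact card_image_le.trans (by simpa using hY)
  obtain ⟨f⟩ := Function.Embedding.nonempty_of_card_le hR
  let T' : D → ι → R := fun i k => ⟨T i k, mem_image_of_mem (fun q : D × ι => T q.1 q.2)
    (mem_univ (i, k))⟩
  have h1 := prob_comp_injective (X := X) (Subtype.val_injective : Function.Injective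
    (Subtype.val : R → V)) (fun x => p fun i => x ∘ T' i)
  have h2 := prob_comp_injective (X := X) f.injective (fun x => p fun i => x ∘ T' i)
  exact (h1.trans h2.symm).trans_le (h fun i k => f (T' i k))

section Embedding

variable {L Δ : ℕ} {V A X : Type*} [DecidableEq V] [Fintype A]

/-- The vertices sharing an edge with `u`. Edges are indexed by `A`, and `τ a k` is the vertex of
the edge `a` in part `k`. -/
def coedge (pV : V → Fin (L + 1)) (τ : A → Fin (L + 1) → V) (u : V) : Finset V :=
  (univ.filter fun a => τ a (pV u) = u).biUnion fun a => univ.image (τ a)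

lemma mem_coedge {pV : V → Fin (L + 1)} {τ : A → Fin (L + 1) → V} (hτ : ∀ a k, pV (τ a k) = k)
    {u v : V} : v ∈ coedge pV τ u ↔ ∃ a, τ a (pV u) = u ∧ τ a (pV v) = v := by
  simp only [coedge, mem_biUnion, mem_filter, mem_univ, true_and, mem_image]
  constructor
  · rintro ⟨a, ha, k, rfl⟩
    exact ⟨a, ha, by rw [hτ]⟩
  · rintro ⟨a, ha, hv⟩
    exact ⟨a, ha, _, hv⟩

lemma card_coedge_le {pV : V → Fin (L + 1)} {τ : A → Fin (L + 1) → V}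
    (hdeg : ∀ v, (univ.filter fun a => τ a (pV v) = v).card ≤ Δ) (u : V) :
    (coedge pV τ u).card ≤ Δ * (L + 1) :=
  (card_biUnion_le_card_mul _ _ (L + 1) fun a _ => card_image_le.trans (by simp)).trans
    (Nat.mul_le_mul_right _ (hdeg u))

lemma exists_enumeration {pV : V → Fin (L + 1)} {τ : A → Fin (L + 1) → V}
    (hdeg : ∀ v, (univ.filter fun a => τ a (pV v) = v).card ≤ Δ) (w : V)
    (hw : ∃ a, τ a (pV w) = w) :
    ∃ c : Fin Δ → A, (∀ i, τ (c i) (pV w) = w) ∧ ∀ a, τ a (pV w) = w → ∃ i, c i = a := by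
  have : Nonempty {a // τ a (pV w) = w} := let ⟨a, ha⟩ := hw; ⟨⟨a, ha⟩⟩
  obtain ⟨f⟩ := Function.Embedding.nonempty_of_card_le (α := {a // τ a (pV w) = w}) (β := Fin Δ)
    (by rw [Fintype.card_subtype, Fintype.card_fin]; exact hdeg w)
  refine ⟨fun i => (Function.invFun f i).1, fun i => (Function.invFun f i).2, fun a ha => ?_⟩
  obtain ⟨i, hi⟩ := Function.invFun_surjective f.injective ⟨a, ha⟩
  exact ⟨i, congrArg Subtype.val hi⟩

lemma exists_embedding_s2 [Fintype V] [Fintype X] [Nonempty X] {pV : V → Fin (L + 1)}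
    {τ : A → Fin (L + 1) → V} (hτ : ∀ a k, pV (τ a k) = k)
    (hdeg : ∀ v, (univ.filter fun a => τ a (pV v) = v).card ≤ Δ) (hΔ : 0 < Δ)
    {γ : ℝ} (hγ : 0 < γ) (hγ1 : γ ≤ 1) (hV : (Fintype.card V : ℝ) ≤ γ / 2 * Fintype.card X)
    {E : ℕ → Set (Fin (L + 1) → X)} (hE : ∀ j, IgnoresBelow j (E j)) (hEL : E (L + 1) = Set.univ)
    (hdanger : ∀ (j : Fin (L + 1)) (c : Fin Δ → Fin (L + 1) → V), prob (fun x : V → X =>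
      Dangerous (E j) (E (j + 1)) j γ (fun i => x ∘ c i)) <
        (γ / (2 * (Δ * (L + 1) : ℕ))) ^ (Δ * (L + 1))) :
    ∃ g : V → X, (∀ u v, pV u = pV v → g u = g v → u = v) ∧ ∀ a, g ∘ τ a ∈ E 0 := by
  classical
  choose c hc hc' using exists_enumeration hdeg
  set m : ℕ := Δ * (L + 1) with hm
  have hm0 : 0 < m := by positivity
  have hm0' : (0 : ℝ) < m := by exact_mod_cast hm0
  set κ : ℝ := γ / (2 * m) with hκ
  have hκ0 : 0 < κ := by positivity
  have hκ1 : κ ≤ 1 := by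
    rw [hκ, div_le_one (by positivity)]
    have : (1 : ℝ) ≤ m := by exact_mod_cast hm0
    linarith
  let Bad : ∀ w, (∃ a, τ a (pV w) = w) → (V → X) → Prop := fun w hw x =>
    Dangerous (E (pV w)) (E (pV w + 1)) (pV w) γ (fun i => x ∘ τ (c w hw i))
  let N : V → Finset V := fun w => univ.filter fun v => pV w < pV v ∧ v ∈ coedge pV τ w
  have hBad : ∀ w hw (x x' : V → X), (∀ v ∈ N w, x v = x' v) → (Bad w hw x ↔ Bad w hw x') := by
    intro w hw x x' hx
    have hx' : ∀ i k, pV w < k → x (τ (c w hw i) k) = x' (τ (c w hw i) k) := fun i k hk =>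
      hx _ (mem_filter.2 ⟨mem_univ _, by rwa [hτ],
        (mem_coedge hτ).2 ⟨c w hw i, hc w hw i, by rw [hτ]⟩⟩)
    refine and_congr (forall_congr' fun i => hE _ _ _ fun k hk => hx' i k hk) ?_
    have : ∀ y i, Function.update (x ∘ τ (c w hw i)) (pV w) y ∈ E (pV w) ↔
        Function.update (x' ∘ τ (c w hw i)) (pV w) y ∈ E (pV w) := fun y i =>
      hE _ _ _ fun k hk => by
        by_cases hkw : k = pV w
        · subst hkw; simp
        · rw [Function.update_of_ne hkw, Function.update_of_ne hkw]
          exact hx' i k (lt_of_le_of_ne hk (Ne.symm hkw))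
    simp only [this]
  have main : ∀ t ≤ Fintype.card V, ∃ (S : Finset V) (g : V → X), S.card = t ∧
      (∀ u ∈ S, ∀ v, pV u < pV v → v ∈ S) ∧
      (∀ u ∈ S, ∀ v ∈ S, pV u = pV v → g u = g v → u = v) ∧
      (∀ v ∈ S, ∀ a, τ a (pV v) = v → g ∘ τ a ∈ E (pV v)) ∧
      ∀ w ∉ S, ∀ hw, prob (fun x => Bad w hw (S.piecewise g x)) < κ ^ (N w \ S).card := by
    intro t
    induction t with
    | zero =>
      refine fun _ => ⟨∅, fun _ => Classical.arbitrary X, rfl, by simp, by simp, by simp,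
        fun w _ hw => ?_⟩
      simp only [piecewise_empty, sdiff_empty]
      refine (hdanger (pV w) fun i => τ (c w hw i)).trans_le ?_
      exact pow_le_pow_of_le_one hκ0.le hκ1
        ((card_le_card fun v hv => (mem_filter.1 hv).2.2).trans (card_coedge_le hdeg w))
    | succ t ih =>
      intro ht
      obtain ⟨S, g, hSt, hup, hinj, hedge, hprob⟩ := ih (by omega)
      have hne : (univ \ S).Nonempty := by
        rw [← card_pos, card_sdiff_of_subset (subset_univ S), card_univ]; omega
      obtain ⟨u, huS, humax⟩ := exists_max_image (univ \ S) pV hne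
      replace huS : u ∉ S := (mem_sdiff.1 huS).2
      have huS' : ∀ v, pV u < pV v → v ∈ S := fun v hv => by
        by_contra h
        exact absurd (humax v (by simp [h])) (not_le.2 hv)
      have hlow : ∀ v ∈ S, pV u ≤ pV v := fun v hv => by
        by_contra! h
        exact huS (hup v hv u h)
      -- There are many candidates for the image of `u`.
      have hcand : γ ≤ prob fun y =>
          ∀ a, τ a (pV u) = u → Function.update (g ∘ τ a) (pV u) y ∈ E (pV u) := by
        by_cases hu : ∃ a, τ a (pV u) = u
        · by_contra! hlt
          have hbad : Bad u hu g := by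
            refine ⟨fun i => ?_, (prob_mono fun y hy a ha => ?_).trans_lt hlt⟩
            · by_cases hL : (pV u).val + 1 < L + 1
              · have hv : τ (c u hu i) ⟨_, hL⟩ ∈ S := huS' _ (by
                  rw [hτ]; exact Fin.lt_def.2 (Nat.lt_succ_self _))
                have := hedge _ hv (c u hu i) (by rw [hτ])
                rwa [hτ] at this
              · rw [show (pV u).val + 1 = L + 1 by omega, hEL]; trivial
            · obtain ⟨i, rfl⟩ := hc' u hu a ha
              exact hy i
          have hN : N u ⊆ S := fun v hv => huS' v (mem_filter.1 hv).2.1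
          have h := hprob u huS hu
          rw [sdiff_eq_empty_iff_subset.2 hN, card_empty, pow_zero] at h
          have h' : ∀ x : V → X, Bad u hu (S.piecewise g x) ↔ True := fun x => by
            rw [iff_true, hBad u hu _ g fun v hv => piecewise_eq_of_mem _ _ _ (hN hv)]
            exact hbad
          simp only [h'] at h
          rw [prob_const] at h
          simp at h
        · push Not at hu
          have h' : ∀ y a, (τ a (pV u) = u →
              Function.update (g ∘ τ a) (pV u) y ∈ E (pV u)) ↔ True :=
            fun y a => iff_true_intro fun h => absurd h (hu a)
          simp only [h', implies_true]
          rw [prob_const, if_pos trivial]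
          exact hγ1
      let q : ∀ w, (∃ a, τ a (pV w) = w) → X → ℝ := fun w hw y =>
        prob fun x => Bad w hw (S.piecewise g (Function.update x u y))
      have hq : ∀ w hw, 𝔼 y, q w hw y = prob fun x => Bad w hw (S.piecewise g x) := fun w hw =>
        expect_prob_update u fun x => Bad w hw (S.piecewise g x)
      let good : Finset X := univ.filter fun y =>
        ∀ a, τ a (pV u) = u → Function.update (g ∘ τ a) (pV u) y ∈ E (pV u)
      let risky : V → Finset X := fun w => univ.filter fun y =>
        w ∉ S ∧ u ∈ N w ∧ ∃ hw, κ ^ (N w \ insert u S).card ≤ q w hw y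
      have hrisky : ∀ w, ((risky w).card : ℝ) ≤ κ * Fintype.card X := by
        intro w
        by_cases h : w ∉ S ∧ u ∈ N w ∧ ∃ a, τ a (pV w) = w
        · obtain ⟨hwS, huN, hw⟩ := h
          have hcard : (N w \ S).card = (N w \ insert u S).card + 1 := by
            rw [sdiff_insert, card_erase_add_one (mem_sdiff.2 ⟨huN, huS⟩)]
          have h1 := card_filter_le_mul_le (f := q w hw) (fun _ => prob_nonneg _)
            (κ ^ (N w \ insert u S).card)
          have h2 : (risky w).card ≤
              (univ.filter fun y => κ ^ (N w \ insert u S).card ≤ q w hw y).card :=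
            card_le_card fun y hy => by
              obtain ⟨-, -, -, _, h⟩ := mem_filter.1 hy
              exact mem_filter.2 ⟨mem_univ _, h⟩
          have h3 := hprob w hwS hw
          rw [hq w hw] at h1
          rw [hcard, pow_succ] at h3
          have hpos : 0 < κ ^ (N w \ insert u S).card := by positivity
          have h2' : ((risky w).card : ℝ) ≤
              (univ.filter fun y => κ ^ (N w \ insert u S).card ≤ q w hw y).card := by
            exact_mod_cast h2
          refine le_of_mul_le_mul_right ?_ hpos
          calc _ ≤ _ := mul_le_mul_of_nonneg_right h2' hpos.le
            _ ≤ _ := h1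
            _ ≤ (κ ^ (N w \ insert u S).card * κ) * Fintype.card X := by gcongr
            _ = _ := by ring
        · have : risky w = ∅ := filter_eq_empty_iff.2 fun y _ hy =>
            h ⟨hy.1, hy.2.1, hy.2.2.1⟩
          rw [this]
          simp only [card_empty, Nat.cast_zero]
          positivity
      have hunion : (((coedge pV τ u).biUnion risky).card : ℝ) ≤ γ / 2 * Fintype.card X := by
        calc (((coedge pV τ u).biUnion risky).card : ℝ)
            ≤ ∑ w ∈ coedge pV τ u, ((risky w).card : ℝ) := by exact_mod_cast card_biUnion_le
          _ ≤ (coedge pV τ u).card * (κ * Fintype.card X) := by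
              rw [← nsmul_eq_mul]; exact sum_le_card_nsmul _ _ _ fun w _ => hrisky w
          _ ≤ m * (κ * Fintype.card X) := by
              gcongr; exact_mod_cast card_coedge_le hdeg u
          _ = γ / 2 * Fintype.card X := by rw [hκ]; field_simp
      obtain ⟨y, hygood, hybad⟩ : ∃ y ∈ good, y ∉ S.image g ∪ (coedge pV τ u).biUnion risky := by
        refine exists_mem_notMem_of_card_lt_card ?_
        have h1 : γ * Fintype.card X ≤ (good.card : ℝ) := by
          rw [card_filter_eq_prob_mul]; gcongr
        have h2 : ((S.image g).card : ℝ) < γ / 2 * Fintype.card X := by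
          refine lt_of_lt_of_le ?_ hV
          exact_mod_cast card_image_le.trans_lt (by omega)
        have h3 : ((S.image g ∪ (coedge pV τ u).biUnion risky).card : ℝ) ≤
            (S.image g).card + ((coedge pV τ u).biUnion risky).card := by
          exact_mod_cast card_union_le _ _
        exact_mod_cast (by linarith :
          ((S.image g ∪ (coedge pV τ u).biUnion risky).card : ℝ) < good.card)
      rw [mem_union, not_or] at hybad
      obtain ⟨hyS, hyrisky⟩ := hybad
      have hg : ∀ v ∈ S, Function.update g u y v = g v := fun v hv =>
        Function.update_of_ne (fun h => huS (by rwa [h] at hv)) _ _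
      refine ⟨insert u S, Function.update g u y, by rw [card_insert_of_notMem huS, hSt],
        ?_, ?_, ?_, ?_⟩
      · intro v hv w hvw
        rcases mem_insert.1 hv with rfl | hv
        · exact mem_insert_of_mem (huS' w hvw)
        · exact mem_insert_of_mem (hup v hv w hvw)
      · intro v hv w hw hvw hgvw
        rcases mem_insert.1 hv with rfl | hv' <;> rcases mem_insert.1 hw with rfl | hw'
        · rfl
        · rw [Function.update_self, hg w hw'] at hgvw
          exact absurd (mem_image.2 ⟨w, hw', hgvw.symm⟩) hyS
        · rw [Function.update_self, hg v hv'] at hgvw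
          exact absurd (mem_image.2 ⟨v, hv', hgvw⟩) hyS
        · rw [hg v hv', hg w hw'] at hgvw
          exact hinj v hv' w hw' hvw hgvw
      · intro v hv a ha
        rcases mem_insert.1 hv with rfl | hv'
        · refine (hE _ _ _ fun k _ => ?_).1 ((mem_filter.1 hygood).2 a ha)
          by_cases hk : k = pV v
          · subst hk; simp [ha]
          · rw [Function.update_of_ne hk, Function.comp_apply, Function.comp_apply,
              Function.update_of_ne]
            rintro rfl
            exact hk (hτ a k).symm
        · refine (hE _ _ _ fun k hk => ?_).1 (hedge v hv' a ha)
          rw [Function.comp_apply, Function.comp_apply, Function.update_of_ne]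
          rintro rfl
          have h1 := hlow v hv'
          rw [hτ] at h1
          obtain rfl : k = pV v := le_antisymm h1 hk
          exact huS (by rwa [ha])
      · intro w hw hwe
        have hwS : w ∉ S := fun h => hw (mem_insert_of_mem h)
        have hpw : ∀ x : V → X, (insert u S).piecewise (Function.update g u y) x =
            S.piecewise g (Function.update x u y) := by
          intro x
          ext v
          by_cases hvu : v = u
          · subst hvu
            simp [huS, piecewise]
          · by_cases hvS : v ∈ S <;> simp [hvu, hvS, piecewise]
        simp only [hpw]
        by_cases huN : u ∈ N w
        · by_contra! hle
          refine hyrisky (mem_biUnion.2 ⟨w, ?_, mem_filter.2 ⟨mem_univ _, hwS, huN, hwe, hle⟩⟩)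
          obtain ⟨a, h1, h2⟩ := (mem_coedge hτ).1 (mem_filter.1 huN).2.2
          exact (mem_coedge hτ).2 ⟨a, h2, h1⟩
        · rw [sdiff_insert_of_notMem huN]
          refine lt_of_eq_of_lt ?_ (hprob w hwS hwe)
          congr 1
          ext x
          refine hBad w hwe _ _ fun v hv => ?_
          have hvu : v ≠ u := fun h => huN (h ▸ hv)
          by_cases hvS : v ∈ S <;> simp [hvu, hvS, piecewise]
  obtain ⟨S, g, hS, -, hinj, hedge, -⟩ := main _ le_rfl
  obtain rfl : S = univ := (card_eq_iff_eq_univ S).1 hS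
  refine ⟨g, fun u v => hinj u (mem_univ _) v (mem_univ _), fun a => ?_⟩
  have := hedge (τ a 0) (mem_univ _) a (by rw [hτ])
  rwa [hτ] at this

end Embedding

lemma exists_section {l : ℕ} {W : Type*} [DecidableEq W] (p : W → Fin l) (e : Finset W)
    (he : ∀ j, (e.filter fun v => p v = j).card = 1) :
    ∃ τ : Fin l → W, (∀ k, p (τ k) = k) ∧ univ.image τ = e := by
  choose τ hτ using fun j => card_eq_one.1 (he j)
  have h1 : ∀ k, τ k ∈ e ∧ p (τ k) = k := fun k =>
    mem_filter.1 (hτ k ▸ mem_singleton_self (τ k))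
  have h2 : ∀ v ∈ e, τ (p v) = v := fun v hv =>
    (mem_singleton.1 (hτ (p v) ▸ mem_filter.2 ⟨hv, rfl⟩)).symm
  refine ⟨τ, fun k => (h1 k).2, Subset.antisymm (fun v hv => ?_) fun v hv =>
    mem_image.2 ⟨p v, mem_univ _, h2 v hv⟩⟩
  obtain ⟨k, -, rfl⟩ := mem_image.1 hv
  exact (h1 k).1

lemma card_le_prob_mul {l : ℕ} {X : Type*} [Fintype X] [Nonempty X] [DecidableEq X]
    (G : Finset (Finset (Fin l × X))) (hG : ∀ e ∈ G, ∀ j, (e.filter fun x => x.1 = j).card = 1) :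
    (G.card : ℝ) ≤
      prob (fun v : Fin l → X => (univ.image fun k => (k, v k)) ∈ G) *
        (Fintype.card X : ℝ) ^ l := by
  have h : G ⊆ (univ.filter fun v : Fin l → X => (univ.image fun k => (k, v k)) ∈ G).image
      fun v => univ.image fun k => (k, v k) := by
    intro e he
    obtain ⟨τ, h1, h2⟩ := exists_section Prod.fst e (hG e he)
    have h3 : (univ.image fun k => (k, (τ k).2)) = e := by
      rw [← h2]
      exact image_congr fun k _ => Prod.ext (h1 k).symm rfl
    exact mem_image.2 ⟨fun k => (τ k).2, mem_filter.2 ⟨mem_univ _, h3 ▸ he⟩, h3⟩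
  have h' := (card_le_card h).trans card_image_le
  have := card_filter_eq_prob_mul fun v : Fin l → X => (univ.image fun k => (k, v k)) ∈ G
  rw [Fintype.card_pi_const, Nat.cast_pow] at this
  rw [← this]
  exact_mod_cast h'

/-- Let l ≥ 3 and let F be an l-uniform l-partite hypergraph (parts given by pF)
with at most n vertices and maximum degree Δ ≥ 1. Let G be an l-uniform l-partite hypergraph
with parts V_1,...,V_l of size N (vertex type Fin l × Fin N) and at least ε·N^l edges,
0 < ε ≤ 1. If N ≥ (ε/2)^{-(2lΔ)^{l-1}}·n then G contains a copy of F. -/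
theorem stmt_2 :
    ∀ (l n Δ : ℕ), 3 ≤ l → 1 ≤ Δ →
    ∀ (F : Finset (Finset (Fin n))) (pF : Fin n → Fin l),
      (∀ e ∈ F, ∀ j : Fin l, (e.filter fun v => pF v = j).card = 1) →
      (∀ v : Fin n, (F.filter fun e => v ∈ e).card ≤ Δ) →
    ∀ (N : ℕ) (G : Finset (Finset (Fin l × Fin N))) (ε : ℝ),
      0 < ε → ε ≤ 1 →
      (∀ e ∈ G, ∀ j : Fin l, (e.filter fun x => x.1 = j).card = 1) →
      ε * (N : ℝ) ^ l ≤ (G.card : ℝ) →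
      (ε / 2) ^ (-(((2 * l * Δ) ^ (l - 1) : ℕ) : ℤ)) * (n : ℝ) ≤ (N : ℝ) →
      ∃ f : Fin n → Fin l × Fin N, Function.Injective f ∧
        ∀ e ∈ F, e.image f ∈ G := by
  intro l n Δ hl hΔ F pF hF hdeg N G ε hε hε1 hG hGcard hN
  classical
  obtain ⟨L, rfl⟩ : ∃ L, l = L + 1 := ⟨l - 1, by omega⟩
  choose τ hτ hτe using fun e : F => exists_section pF e.1 (hF e.1 e.2)
  rcases Nat.eq_zero_or_pos n with rfl | hn
  · exact ⟨fun v => v.elim0, fun v => v.elim0, fun e he => (τ ⟨e, he⟩ 0).elim0⟩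
  have hN0 : 0 < N := by
    have : (0 : ℝ) < n := by exact_mod_cast hn
    have : (0 : ℝ) < N := lt_of_lt_of_le (by positivity) hN
    exact_mod_cast this
  have : Nonempty (Fin N) := ⟨⟨0, hN0⟩⟩
  have hN0' : (0 : ℝ) < N := by exact_mod_cast hN0
  set m : ℕ := Δ * (L + 1) with hm
  have hm3 : 3 ≤ m := hl.trans (Nat.le_mul_of_pos_left _ hΔ)
  have : Nonempty (Fin m) := ⟨⟨0, by omega⟩⟩
  have hs : 2 * m - 1 + 1 = 2 * m := by omega
  set γ : ℝ := levelDensity ε (2 * m) L with hγ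
  have hγ0 : 0 < γ := levelDensity_pos hε L
  let E₀ : Set (Fin (L + 1) → Fin N) := {v | (univ.image fun k => (k, v k)) ∈ G}
  have hE₀ : ε ≤ prob (· ∈ E₀) := by
    have h := hGcard.trans (card_le_prob_mul G hG)
    rw [Fintype.card_fin] at h
    exact le_of_mul_le_mul_right h (by positivity)
  obtain ⟨E, hE0, hE, hEL, hdanger⟩ := exists_chain_s2 (D := Fin Δ) (Y := Fin m) (s := 2 * m - 1)
    hε hε1 hγ0 (by rw [hs]) E₀ hE₀
  have hP : Fintype.card (Fin Δ → Fin (L + 1) → Fin m) = m ^ m := by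
    simp only [Fintype.card_pi_const, Fintype.card_fin]
    rw [← pow_mul, hm, mul_comm Δ]
  have hlt : (m : ℝ) ^ m * γ ^ (2 * m - 1) < (γ / (2 * m)) ^ m :=
    pow_mul_pow_lt_pow hm3 hγ0 (levelDensity_le_inv_pow hε hε1 (by omega) (by omega))
  have hV : (Fintype.card (Fin n) : ℝ) ≤ γ / 2 * Fintype.card (Fin N) := by
    have h1 : 2 * (ε / 2) ^ (2 * m) ^ L ≤ γ := two_mul_pow_le_levelDensity hε (by omega) L
    have h2 : 2 * (L + 1) * Δ = 2 * m := by rw [hm]; ring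
    rw [h2, Nat.add_sub_cancel, zpow_neg, zpow_natCast, inv_mul_le_iff₀ (by positivity)] at hN
    simp only [Fintype.card_fin]
    refine hN.trans ?_
    gcongr
    linarith
  have hdeg' : ∀ v, (univ.filter fun e : F => τ e (pF v) = v).card ≤ Δ := by
    intro v
    refine le_trans ?_ (hdeg v)
    rw [← card_map (Function.Embedding.subtype _)]
    refine card_le_card fun e he => ?_
    obtain ⟨e', he', rfl⟩ := mem_map.1 he
    refine mem_filter.2 ⟨e'.2, ?_⟩
    have h := (mem_filter.1 he').2
    have : v ∈ univ.image (τ e') := mem_image.2 ⟨_, mem_univ _, h⟩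
    rwa [hτe] at this
  obtain ⟨g, hinj, hg⟩ := exists_embedding_s2 hτ hdeg' hΔ hγ0 (levelDensity_le_one hε hε1 L) hV hE hEL
    fun j c => by
      refine lt_of_le_of_lt (prob_comp_le_of_card_le (Y := Fin m) c (by simp [hm])
        (fun t => Dangerous (E j) (E (j + 1)) j γ t) (hdanger j)) ?_
      rw [hP]
      exact_mod_cast hlt
  refine ⟨fun v => (pF v, g v), fun u v h => hinj u v (congrArg Prod.fst h) (congrArg Prod.snd h),
    fun e he => ?_⟩
  have h := hg ⟨e, he⟩
  rw [hE0] at h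
  have h2 : (univ.image fun k => (k, (g ∘ τ ⟨e, he⟩) k)) = e.image fun v => (pF v, g v) := by
    refine Eq.trans ?_ (congrArg (Finset.image fun v => (pF v, g v)) (hτe ⟨e, he⟩))
    rw [image_image]
    exact image_congr fun k _ => by simp [hτ]
  rw [← h2]
  exact h
end
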